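/- Let H be the presented group on generators x_i (i \in \mathbb{N}) with relators: x_i^2 for all i; w^4 for every word w in the generators; and [x_i^g, x_i^h] for all i and all words g, h in the generators (so that each normal closure <x_i>^H is abelian and H has exponent 4). Let N be a normal subgroup of H whose underlying set equals R_2(H), and set \bar{H} = H/N. Then every involution u of \bar{H} is a left 2-Engel element of \bar{H} (i.e., [x,u,u] = 1 for all x in \bar{H}), and \bar{H} is not solvable. -/

import Mathlib

/-- Left-normed commutator `[a,b] = a⁻¹ * b⁻¹ * a * b`. -/
def lcomm {G : Type*} [Group G] (a b : G) : G := a⁻¹ * b⁻¹ * a * b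

/-- The set of right 2-Engel elements of `G`:
`R₂(G) = {a ∈ G : [a,x,x] = 1 for all x ∈ G}`. -/
def R2 (G : Type*) [Group G] : Set G := {a | ∀ x : G, lcomm (lcomm a x) x = 1}

/-- The relators of the group `H`: `xᵢ²` for all `i`; `w⁴` for every word `w`;
and `[xᵢᵍ, xᵢʰ]` for all `i` and all words `g, h` (so each normal closure `⟨xᵢ⟩ᴴ`
is abelian and `H` has exponent 4). -/
def Hrels : Set (FreeGroup ℕ) :=
  {r | (∃ i : ℕ, r = FreeGroup.of i ^ 2) ∨
       (∃ w : FreeGroup ℕ, r = w ^ 4) ∨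
       (∃ (i : ℕ) (g h : FreeGroup ℕ),
          r = lcomm (g⁻¹ * FreeGroup.of i * g) (h⁻¹ * FreeGroup.of i * h))}

/-- The group `H`: freest group generated by involutions `xᵢ`, of exponent 4, in which
each `xᵢ` has abelian normal closure. -/
abbrev H : Type := PresentedGroup Hrels

section PluckerForms

variable {C V : Type*} [CommRing C] [AddCommGroup V] [Module C V]

/-- An alternating bilinear form in characteristic two satisfying the three-term Plücker relation
and the vanishing of the cyclic cubic sums `∑ B a p * B b q • r`. -/
structure IsPluckerForm (B : V →ₗ[C] V →ₗ[C] C) : Prop where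
  alt : ∀ v, B v v = 0
  symm : ∀ v w, B v w = B w v
  plucker : ∀ u v w, B u v • w + B v w • u + B w u • v = 0
  cyclic : ∀ a b p q r,
    (B a p * B b q) • r + (B a q * B b r) • p + (B a r * B b p) • q = 0

/-- Vectors on which every expression quadratic in them vanishes. -/
def IsLetter (B : V →ₗ[C] V →ₗ[C] C) (a : V) : Prop := ∀ x, B a x • a = 0

/-- The adjoint action of `a` on the Lie algebra `C × V`. -/
def adj (B : V →ₗ[C] V →ₗ[C] C) (a : V) : Module.End C (C × V) :=
  (B.flip a ∘ₗ LinearMap.snd C C V).prod ((LinearMap.toSpanSingleton C V a) ∘ₗ LinearMap.fst C C V)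

/-- The endomorphism of `C × V` with the given matrix entries. -/
def blockEnd (B : V →ₗ[C] V →ₗ[C] C) (s : C) (u r : V) (T : V →ₗ[C] V) :
    Module.End C (C × V) :=
  (s • LinearMap.fst C C V + B.flip r ∘ₗ LinearMap.snd C C V).prod
    ((LinearMap.toSpanSingleton C V u) ∘ₗ LinearMap.fst C C V + T ∘ₗ LinearMap.snd C C V)

@[simp] lemma adj_apply (B : V →ₗ[C] V →ₗ[C] C) (a : V) (x : C × V) :
    adj B a x = (B x.2 a, x.1 • a) := rfl

@[simp] lemma blockEnd_apply (B : V →ₗ[C] V →ₗ[C] C) (s : C) (u r : V) (T : V →ₗ[C] V)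
    (x : C × V) :
    blockEnd B s u r T x = (s * x.1 + B x.2 r, x.1 • u + T x.2) := rfl

/-- The identities between the matrix entries of a product of elements `1 + adj B a`,
`a` a letter; `n` is the trace of the lower right block. -/
structure IsGroupLike (B : V →ₗ[C] V →ₗ[C] C) (s n : C) (u r : V) (T : V →ₗ[C] V) : Prop where
  s_sq : s * s = 0
  n_sq : n * n = 0
  n_mul_s : n * s = 0
  s_smul_u : s • u = 0
  s_smul_r : s • r = 0
  n_smul_u : n • u = 0
  s_smul : ∀ a, s • a = B u a • u
  n_smul : ∀ a, n • a = B a r • u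
  smul_add : ∀ a b, B a b • (u + r) = B a (T b) • u
  smul_map : ∀ a b c, B a b • T c + (s * B a b) • c + (n * B a b) • c =
    B a (T b) • c + (s * B a (T b)) • c + (n * B a c) • b
  adjoint : ∀ a b, B (T a) b + B a (T b) = n * B a b
  r_eq : r = u + T u
  form_u_r : B u r = 0
  map_r : T r = u + r
  map_map : ∀ a, T (T a) = n • T a + n • a + s • a
  form_map_letter : ∀ a, IsLetter B a → B a (T a) = 0

lemma isGroupLike_zero (B : V →ₗ[C] V →ₗ[C] C) : IsGroupLike B 0 0 0 0 0 := by
  constructor <;> simp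

variable {B : V →ₗ[C] V →ₗ[C] C} {s n : C} {u r : V} {T : V →ₗ[C] V}

lemma add_self_module [CharP C 2] (v : V) : v + v = 0 := by
  rw [← two_smul C v, CharTwo.two_eq_zero, zero_smul]

lemma IsLetter.mul_form {a : V} (ha : IsLetter B a) (x y : V) : B a x * B a y = 0 := by
  have := congrArg (fun v => B v y) (ha x)
  simpa using this

theorem IsGroupLike.blockEnd_cube [CharP C 2] (hB : IsPluckerForm B)
    (h : IsGroupLike B s n u r T) : blockEnd B s u r T ^ 3 = 0 := by
  have nr : n • r = 0 := by rw [h.n_smul, hB.alt, zero_smul]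
  have hTr : ∀ v, B (T v) r = B v u + B v r := fun v => by
    have h1 := h.adjoint v r
    have h2 : n * B v r = 0 := by simpa using congrArg (B v) nr
    rw [h.map_r, map_add, h2] at h1
    grind
  have sr : ∀ v, s * B v r = 0 := fun v => by simpa using congrArg (B v) h.s_smul_r
  have nr' : ∀ v, n * B v r = 0 := fun v => by simpa using congrArg (B v) nr
  have hTu : T u = u + r := by
    have := h.r_eq
    have h2 := add_self_module (C := C) u
    rw [this, ← add_assoc, h2, zero_add]
  have sT : ∀ v, s • T v = n • T v := fun v => by
    have h1 := h.smul_add u v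
    rw [h.s_smul (T v), ← h1, h.n_smul (T v), hTr]
    have h2 := hB.plucker u v r
    rw [hB.symm r u, h.form_u_r, zero_smul, add_zero] at h2
    linear_combination (norm := skip) h2
    rw [hB.symm v u]
    match_scalars <;> grind
  have key : ∀ x : C × V, (blockEnd B s u r T * (blockEnd B s u r T * blockEnd B s u r T)) x = 0 := by
    rintro ⟨c, v⟩
    have e1 : blockEnd B s u r T (blockEnd B s u r T (c, v)) =
        (B (T v) r, c • (u + r) + n • T v + s • v) := by
      simp only [blockEnd_apply, map_add, map_smul, LinearMap.add_apply, LinearMap.smul_apply,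
        smul_eq_mul, h.form_u_r, h.map_map, hTu]
      ext
      · have := h.s_sq; have := sr v; dsimp; grind
      · have h1 := h.s_smul_u
        have h2 := h.n_smul v
        linear_combination (norm := skip) c • h1 + h2
        match_scalars <;> grind
    simp only [Module.End.mul_apply]
    rw [e1]
    simp only [blockEnd_apply, map_add, map_smul, LinearMap.add_apply, LinearMap.smul_apply,
        smul_eq_mul, h.form_u_r, h.map_map, hTu, h.map_r, hB.alt]
    ext
    · have := sr (T v); have := nr' (T v); have := sr v; dsimp; grind
    · have h1 := h.n_smul (T v)
      have h2 := sT v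
      have h3 := h.n_sq; have h4 := h.n_mul_s
      dsimp
      linear_combination (norm := skip) h1 + h2
      match_scalars <;> grind
  rw [pow_succ', pow_two]
  exact LinearMap.ext key

theorem IsGroupLike.step [CharP C 2] (hB : IsPluckerForm B)
    (h : IsGroupLike B s n u r T) {a : V} (ha : IsLetter B a) :
    IsGroupLike B (s + B u a) (n + B a r) (u + (1 + s) • a) ((1 + n) • a + r + T a)
      (T + (B.flip r).smulRight a) := by
  have nr : n • r = 0 := by rw [h.n_smul, hB.alt, zero_smul]
  have sr : ∀ v, s * B v r = 0 := fun v => by simpa using congrArg (B v) h.s_smul_r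
  have nr' : ∀ v, n * B v r = 0 := fun v => by simpa using congrArg (B v) nr
  have su : ∀ v, s * B u v = 0 := fun v => by simpa using congrArg (B.flip v) h.s_smul_u
  have nu : ∀ v, n * B u v = 0 := fun v => by simpa using congrArg (B.flip v) h.n_smul_u
  have hTr : ∀ v, B (T v) r = B v u + B v r := fun v => by
    have h1 := h.adjoint v r
    rw [h.map_r, map_add, nr'] at h1
    grind
  have hTu : T u = u + r := by
    have := h.r_eq
    have h2 := add_self_module (C := C) u
    rw [this, ← add_assoc, h2, zero_add]
  have la2 := ha.mul_form
  have haT : ∀ x, B a x • T a = 0 := fun x => by simpa using congrArg T (ha x)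
  have bTa : ∀ x, B x (T a) • a = 0 := fun x => by
    have h1 := h.adjoint x a
    have h2 := ha (T x)
    have h3 := ha x
    rw [hB.symm a] at h2 h3
    linear_combination (norm := skip) h1 • a + h2 + n • h3
    match_scalars <;> grind
  have sa := h.s_smul a
  have na := h.n_smul a
  have aTa := h.form_map_letter a ha
  have hss := h.s_sq
  have hnn := h.n_sq
  have hns := h.n_mul_s
  have ua := hB.symm u a
  have hsTa : s • T a = B u a • (u + r) := by rw [h.s_smul (T a), h.smul_add u a]
  constructor
  · have := su a; have := la2 u u; grind
  · have := nr' a; have := la2 r r; grind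
  · have := nu a; have := sr a; have := la2 r u; grind
  · have := ha u
    have := h.s_smul_u
    linear_combination (norm := skip) sa + this + ‹B a u • a = 0› + s • ‹B a u • a = 0› + hss • a
    match_scalars <;> grind
  · linear_combination (norm := skip) sa + hsTa + h.s_smul_r + ha u + haT u + n • ha u + hns • a
    match_scalars <;> grind
  · linear_combination (norm := skip) h.n_smul_u + na + hns • a + ha r + s • ha r
    match_scalars <;> grind
  · intro b
    have := su b
    linear_combination (norm := skip) h.s_smul b + hB.plucker u a b + ha b +
      (B a b) • h.s_smul_u + (s * s) • ha b
    simp only [map_add, map_smul, LinearMap.add_apply, LinearMap.smul_apply, smul_eq_mul,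
      hB.symm b u]
    match_scalars <;> grind
  · intro b
    have h1 := ha b
    have h2 := hB.symm a b
    have h3 := sr b
    have h4 := hB.symm b r
    linear_combination (norm := skip) h.n_smul b + h.smul_add b a + hB.plucker a r b +
      (1 + s) • (1 + n) • ha b + (1 + s) • bTa b + B b a • h.n_smul_u + h3 • a
    simp only [map_add, map_smul, LinearMap.add_apply, LinearMap.smul_apply, smul_eq_mul]
    match_scalars <;> grind
  · intro b c
    have h1 := ha b
    have h2 := hB.symm a b
    linear_combination (norm := skip) h.smul_add b c + h.smul_map b c a + (B b a) • h.n_smul c +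
      ((1 + s) * B c r) • h1
    simp only [map_add, map_smul, LinearMap.add_apply, LinearMap.smul_apply, smul_eq_mul,
      LinearMap.smulRight_apply, LinearMap.flip_apply]
    match_scalars <;> grind
  · intro b c d
    have h1 := congrArg (fun v => B v a) (h.smul_add b c)
    simp only [map_add, map_smul, LinearMap.add_apply, LinearMap.smul_apply, smul_eq_mul] at h1
    have h2 := hB.cyclic b r c d a
    have h3 := sr c
    have h4 := la2 u b
    have h5 := hB.symm a b
    have h6 := hB.symm r d
    have h7 := hB.symm r a
    have h8 := hB.symm r c
    linear_combination (norm := skip) h.smul_map b c d + h1 • d + h2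
    simp only [map_add, map_smul, LinearMap.add_apply, LinearMap.smul_apply, smul_eq_mul,
      LinearMap.smulRight_apply, LinearMap.flip_apply]
    match_scalars <;> grind
  · intro b c
    have h1 := congrArg (fun v => B v r) (hB.plucker b c a)
    simp only [map_add, map_smul, LinearMap.add_apply, LinearMap.smul_apply, smul_eq_mul,
      map_zero, LinearMap.zero_apply] at h1
    have h2 := h.adjoint b c
    have h3 := hB.symm a c
    simp only [map_add, map_smul, LinearMap.add_apply, LinearMap.smul_apply, smul_eq_mul,
      LinearMap.smulRight_apply, LinearMap.flip_apply]
    have h4 := hB.symm a b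
    grind
  · have h1 := hB.plucker u a r
    rw [hB.symm r u, h.form_u_r, zero_smul, add_zero] at h1
    linear_combination (norm := skip) h.r_eq + na + sa + hsTa + h1 + (1 + s) • ha r
    simp only [map_add, map_smul, LinearMap.add_apply, LinearMap.smul_apply, smul_eq_mul,
      LinearMap.smulRight_apply, LinearMap.flip_apply, h.form_u_r]
    match_scalars <;> grind
  · have h1 := h.adjoint a u
    rw [hTu, map_add, hB.symm (T a) u] at h1
    have h2 := nu a
    have h3 := sr a
    simp only [map_add, map_smul, LinearMap.add_apply, LinearMap.smul_apply, smul_eq_mul,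
      h.form_u_r, hB.alt, aTa]
    grind
  · linear_combination (norm := skip) h.map_r + h.map_map a + (1 + n) • ha r + ha u + ha r
    simp only [map_add, map_smul, LinearMap.add_apply, LinearMap.smul_apply, smul_eq_mul,
      LinearMap.smulRight_apply, LinearMap.flip_apply, hB.alt, hTr]
    match_scalars <;> grind
  · intro b
    have h1 := congrArg T (hB.plucker a b r)
    simp only [map_add, map_smul, map_zero, h.map_r] at h1
    have h2 := nr' b
    have h3 := hB.symm r a
    have h4 := hB.symm u a
    linear_combination (norm := skip) h.map_map b + h1 + hB.plucker a b u + hB.plucker a b r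
    simp only [map_add, map_smul, LinearMap.add_apply, LinearMap.smul_apply, smul_eq_mul,
      LinearMap.smulRight_apply, LinearMap.flip_apply, hTr]
    match_scalars <;> grind
  · intro d hd
    have := hd.mul_form r a
    simp only [map_add, map_smul, LinearMap.add_apply, LinearMap.smul_apply, smul_eq_mul,
      LinearMap.smulRight_apply, LinearMap.flip_apply, h.form_map_letter d hd]
    rw [this, add_zero]

lemma adj_mul_self {a : V} (ha : IsLetter B a) (hB : IsPluckerForm B) : adj B a * adj B a = 0 := by
  refine LinearMap.ext fun x => ?_
  have := ha x.2
  simp [hB.alt, hB.symm x.2 a, this]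

lemma adj_mul_blockEnd_mul_adj (hB : IsPluckerForm B) (h : IsGroupLike B s n u r T) {a : V}
    (ha : IsLetter B a) : adj B a * blockEnd B s u r T * adj B a = 0 := by
  refine LinearMap.ext fun x => ?_
  have h1 := ha x.2
  have h2 := ha.mul_form x.2 u
  have h3 := h.form_map_letter a ha
  have h4 := ha r
  simp only [Module.End.mul_apply, adj_apply, blockEnd_apply, map_add, map_smul,
    LinearMap.add_apply, LinearMap.smul_apply, smul_eq_mul, hB.symm x.2 a, hB.symm u a,
    hB.symm (T a) a, h3, h2, LinearMap.zero_apply]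
  ext
  · simp
  · dsimp
    linear_combination (norm := module) s • h1 + x.1 • h4

lemma IsGroupLike.one_add_adj_mul [CharP C 2] (h : IsGroupLike B s n u r T) (a : V) :
    (1 + adj B a) * (1 + blockEnd B s u r T) =
      1 + blockEnd B (s + B u a) (u + (1 + s) • a) ((1 + n) • a + r + T a)
      (T + (B.flip r).smulRight a) := by
  refine LinearMap.ext fun x => ?_
  have h1 := h.adjoint x.2 a
  simp only [Module.End.mul_apply, adj_apply, blockEnd_apply, map_add, map_smul,
    LinearMap.add_apply, LinearMap.smul_apply, smul_eq_mul, Module.End.one_apply,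
    LinearMap.smulRight_apply, LinearMap.flip_apply, Prod.fst_add, Prod.snd_add]
  ext
  · dsimp
    linear_combination (norm := skip) h1
    grind
  · dsimp
    module

/-- The unit `1 + adj B a` attached to a letter. -/
def letterUnit [CharP C 2] (hB : IsPluckerForm B) {a : V} (ha : IsLetter B a) :
    (Module.End C (C × V))ˣ where
  val := 1 + adj B a
  inv := 1 + adj B a
  val_inv := by
    have h1 := adj_mul_self ha hB
    have h2 := add_self_module (C := C) (adj B a)
    rw [mul_add, add_mul, add_mul, h1]
    simp [add_assoc, h2]
  inv_val := by
    have h1 := adj_mul_self ha hB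
    have h2 := add_self_module (C := C) (adj B a)
    rw [mul_add, add_mul, add_mul, h1]
    simp [add_assoc, h2]

@[simp] lemma letterUnit_val [CharP C 2] (hB : IsPluckerForm B) (ha : IsLetter B a) :
    (letterUnit hB ha : Module.End C (C × V)) = 1 + adj B a := rfl

@[simp] lemma letterUnit_inv [CharP C 2] (hB : IsPluckerForm B) (ha : IsLetter B a) :
    (letterUnit hB ha)⁻¹ = letterUnit hB ha := rfl

lemma exists_isGroupLike_of_mem_closure [CharP C 2] (hB : IsPluckerForm B) {w : ℕ → V}
    (hw : ∀ i, IsLetter B (w i)) {g : (Module.End C (C × V))ˣ}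
    (hg : g ∈ Subgroup.closure (Set.range fun i => letterUnit hB (hw i))) :
    ∃ s n u r T, IsGroupLike B s n u r T ∧
      (g : Module.End C (C × V)) = 1 + blockEnd B s u r T := by
  induction hg using Subgroup.closure_induction_left with
  | one =>
    refine ⟨0, 0, 0, 0, 0, isGroupLike_zero B, ?_⟩
    refine LinearMap.ext fun x => ?_
    simp
  | mul_left x hx y hy ih =>
    obtain ⟨i, rfl⟩ := hx
    obtain ⟨s, n, u, r, T, h, hy⟩ := ih
    refine ⟨_, _, _, _, _, h.step hB (hw i), ?_⟩
    rw [Units.val_mul, hy, letterUnit_val, h.one_add_adj_mul]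
  | inv_mul_cancel x hx y hy ih =>
    obtain ⟨i, rfl⟩ := hx
    obtain ⟨s, n, u, r, T, h, hy⟩ := ih
    refine ⟨_, _, _, _, _, h.step hB (hw i), ?_⟩
    rw [Units.val_mul, hy, letterUnit_inv, letterUnit_val, h.one_add_adj_mul]

lemma letterUnit_commute_conj [CharP C 2] (hB : IsPluckerForm B) (ha : IsLetter B a)
    {k : (Module.End C (C × V))ˣ}
    (hk : adj B a * (k : Module.End C (C × V)) * adj B a = 0)
    (hk' : adj B a * ((k⁻¹ : (Module.End C (C × V))ˣ) : Module.End C (C × V)) * adj B a = 0) :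
    Commute (letterUnit hB ha) (k⁻¹ * letterUnit hB ha * k) := by
  rw [Commute, SemiconjBy, Units.ext_iff]
  simp only [Units.val_mul, letterUnit_val]
  have e1 : ((k⁻¹ : (Module.End C (C × V))ˣ) : Module.End C (C × V)) * (1 + adj B a) * k =
      1 + ((k⁻¹ : (Module.End C (C × V))ˣ) : Module.End C (C × V)) * adj B a * k := by
    rw [mul_add, add_mul, mul_one, Units.inv_mul]
  rw [e1]
  have h1 : adj B a * (((k⁻¹ : (Module.End C (C × V))ˣ) : Module.End C (C × V)) * adj B a * k) = 0 := by
    rw [← mul_assoc, ← mul_assoc, hk', zero_mul]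
  have h2 : (((k⁻¹ : (Module.End C (C × V))ˣ) : Module.End C (C × V)) * adj B a * k) * adj B a = 0 := by
    rw [mul_assoc, mul_assoc, ← mul_assoc (adj B a), hk, mul_zero]
  simp only [mul_add, add_mul, mul_one, one_mul, h1, h2]
  abel

lemma commute_conj_of_commute {G : Type*} [Group G] {a g h : G}
    (hc : Commute a ((h * g⁻¹)⁻¹ * a * (h * g⁻¹))) : Commute (g⁻¹ * a * g) (h⁻¹ * a * h) := by
  have := hc.map (MulAut.conj g⁻¹)
  simpa [MulAut.conj_apply, mul_assoc] using this

lemma lcomm_eq_one_of_commute {G : Type*} [Group G] {a b : G} (h : Commute a b) :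
    lcomm a b = 1 := by
  rw [lcomm, mul_assoc, h.eq]; group

lemma lift_letterUnit_rel [CharP C 2] (hB : IsPluckerForm B) {w : ℕ → V}
    (hw : ∀ i, IsLetter B (w i)) :
    ∀ r ∈ Hrels, FreeGroup.lift (fun i => letterUnit hB (hw i)) r = 1 := by
  have hmem : ∀ g, FreeGroup.lift (fun i => letterUnit hB (hw i)) g ∈
      Subgroup.closure (Set.range fun i => letterUnit hB (hw i)) := fun g => by
    rw [← FreeGroup.range_lift_eq_closure]
    exact ⟨g, rfl⟩
  have hadj : ∀ (g : FreeGroup ℕ) i, adj B (w i) *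
      (FreeGroup.lift (fun i => letterUnit hB (hw i)) g : Module.End C (C × V)) *
        adj B (w i) = 0 := by
    intro g i
    obtain ⟨s, n, u, r, T, h, hy⟩ := exists_isGroupLike_of_mem_closure hB hw (hmem g)
    rw [hy, mul_add, add_mul, adj_mul_blockEnd_mul_adj hB h (hw i), mul_one,
      adj_mul_self (hw i) hB, add_zero]
  rintro r (⟨i, rfl⟩ | ⟨g, rfl⟩ | ⟨i, g, h, rfl⟩)
  · rw [map_pow, FreeGroup.lift_apply_of, pow_two]
    exact Units.ext (letterUnit hB (hw i)).val_inv
  · obtain ⟨s, n, u, r, T, h, hy⟩ := exists_isGroupLike_of_mem_closure hB hw (hmem g)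
    rw [map_pow, Units.ext_iff, Units.val_pow_eq_pow_val, hy]
    have h3 := h.blockEnd_cube hB
    set M := blockEnd B s u r T
    have h2 := add_self_module (C := C) M
    have h2' := add_self_module (C := C) (M * M)
    have e2 : (1 + M) * (1 + M) = 1 + M * M := by
      simp only [mul_add, add_mul, mul_one, one_mul]
      linear_combination (norm := skip) h2
      abel_nf
    have e4 : (M * M) * (M * M) = 0 := by
      rw [show (M * M) * (M * M) = M ^ 3 * M by simp [pow_succ, mul_assoc], h3, zero_mul]
    rw [pow_succ, pow_succ, pow_two, mul_assoc, e2]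
    simp only [mul_add, add_mul, mul_one, one_mul, e4, Units.val_one]
    linear_combination (norm := skip) h2'
    abel_nf
  · have hk := hadj (h * g⁻¹) i
    have hk' := hadj (h * g⁻¹)⁻¹ i
    have := commute_conj_of_commute (g := FreeGroup.lift (fun i => letterUnit hB (hw i)) g)
      (h := FreeGroup.lift (fun i => letterUnit hB (hw i)) h)
      (letterUnit_commute_conj hB (hw i) (by simpa using hk) (by simpa using hk'))
    simpa [lcomm] using lcomm_eq_one_of_commute this

/-- Balanced iterated commutators: in `nestedComm x k i` every vertex of a binary tree of depth
`k` rooted at `i` contributes its own letter. -/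
def nestedComm {G : Type*} [Group G] (x : ℕ → G) : ℕ → ℕ → G
  | 0, i => x i
  | k + 1, i => lcomm (lcomm (nestedComm x k (2 * i + 1)) (nestedComm x k (2 * i + 2))) (x i)

/-- The vector describing the action of `nestedComm`. -/
def nestedVector (B : V →ₗ[C] V →ₗ[C] C) (w : ℕ → V) : ℕ → ℕ → V
  | 0, i => w i
  | k + 1, i => B (nestedVector B w k (2 * i + 1)) (nestedVector B w k (2 * i + 2)) • w i

lemma IsLetter.smul {a : V} (ha : IsLetter B a) (c : C) : IsLetter B (c • a) := fun x => by
  have := ha x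
  rw [map_smul, LinearMap.smul_apply, smul_comm, smul_assoc, this, smul_zero, smul_zero]

lemma isLetter_nestedVector {w : ℕ → V} (hw : ∀ i, IsLetter B (w i)) (k i : ℕ) :
    IsLetter B (nestedVector B w k i) := by
  cases k with
  | zero => exact hw i
  | succ k => exact (hw i).smul _

lemma comm_mul_of_sq_zero {R : Type*} [Ring R] (h2 : ∀ x : R, x + x = 0) {X Y : R} (hX : X * X = 0)
    (hY : Y * Y = 0) (hXY : X * Y * X = 0) (hYX : Y * X * Y = 0) :
    (1 + X) * (1 + Y) * (1 + X) * (1 + Y) = 1 + (X * Y + Y * X) := by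
  have e1 : (1 + X) * (1 + Y) * (1 + X) * (1 + Y) = 1 + (X * Y + Y * X) + (X + X) + (Y + Y)
    + (X * Y + X * Y) + X * X + X * X * Y + (Y * Y) + X * (Y * Y) + X * Y * X + X * Y * X * Y + Y * X * Y := by
    noncomm_ring
  rw [e1, hX, hY, hXY, hYX, h2, h2, h2]
  simp

lemma letterUnit_lcomm_lcomm [CharP C 2] (hB : IsPluckerForm B) {a b w : V} (ha : IsLetter B a)
    (hb : IsLetter B b) (hw : IsLetter B w) :
    lcomm (lcomm (letterUnit hB ha) (letterUnit hB hb)) (letterUnit hB hw) =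
      letterUnit hB (hw.smul (B a b)) := by
  have hchar := add_self_module (C := C) (V := Module.End C (C × V))
  have sandwich : ∀ {a b : V}, IsLetter B a → adj B a * adj B b * adj B a = 0 := by
    intro a b ha
    refine LinearMap.ext fun x => ?_
    have h1 := ha b
    have h2 := ha.mul_form x.2 b
    ext <;> simp [hB.symm x.2 a, hB.symm b a, h1, h2, mul_smul]
  have hZ2 : B a b * B a b = 0 := ha.mul_form b b
  set Z : Module.End C (C × V) := adj B a * adj B b + adj B b * adj B a with hZ
  have Zx : ∀ x, Z x = (0, B a b • x.2) := by
    intro x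
    have h1 := hB.plucker x.2 b a
    have h2 : x.1 * B a b + x.1 * B a b = 0 := by grind
    ext
    · simp [hZ, hB.symm b a, h2]
    · simp only [hZ, LinearMap.add_apply, Module.End.mul_apply, adj_apply, Prod.snd_add]
      have h3 := hB.symm a x.2
      have h4 := hB.symm b a
      linear_combination (norm := skip) h1
      match_scalars <;> grind
  have e1 : ((lcomm (letterUnit hB ha) (letterUnit hB hb) : (Module.End C (C × V))ˣ) :
      Module.End C (C × V)) = 1 + Z := by
    simp only [lcomm, letterUnit_inv, Units.val_mul, letterUnit_val]
    exact comm_mul_of_sq_zero hchar (adj_mul_self ha hB) (adj_mul_self hb hB) (sandwich ha)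
      (sandwich hb)
  have ZZ : Z * Z = 0 := by
    refine LinearMap.ext fun x => ?_
    simp [Zx, smul_smul, hZ2]
  have e2 : (lcomm (letterUnit hB ha) (letterUnit hB hb))⁻¹ =
      lcomm (letterUnit hB ha) (letterUnit hB hb) := by
    rw [inv_eq_iff_mul_eq_one, Units.ext_iff, Units.val_mul, e1]
    simp only [mul_add, add_mul, mul_one, one_mul, ZZ, Units.val_one]
    simp [add_assoc, hchar]
  rw [lcomm, e2, letterUnit_inv, Units.ext_iff]
  simp only [Units.val_mul, letterUnit_val, e1]
  rw [comm_mul_of_sq_zero hchar ZZ (adj_mul_self hw hB)]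
  · congr 1
    refine LinearMap.ext fun x => ?_
    simp [Zx, smul_smul, mul_comm]
  · refine LinearMap.ext fun x => ?_
    simp [Zx]
  · refine LinearMap.ext fun x => ?_
    simp [Zx, hB.alt, hB.symm x.2 w, smul_smul, mul_comm (B a b)]

theorem nestedVector_eq_zero [CharP C 2] (hB : IsPluckerForm B) {w : ℕ → V}
    (hw : ∀ i, IsLetter B (w i)) {k i : ℕ}
    (h : nestedComm (fun i => (PresentedGroup.of i : H)) k i = 1) : nestedVector B w k i = 0 := by
  have key : ∀ k i, PresentedGroup.toGroup (lift_letterUnit_rel hB hw)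
      (nestedComm (fun i => (PresentedGroup.of i : H)) k i) =
        letterUnit hB (isLetter_nestedVector hw k i) := by
    intro k
    induction k with
    | zero => intro i; simp only [nestedComm, PresentedGroup.toGroup.of]; rfl
    | succ k ih =>
      intro i
      have := letterUnit_lcomm_lcomm hB (isLetter_nestedVector hw k (2 * i + 1))
        (isLetter_nestedVector hw k (2 * i + 2)) (hw i)
      simp only [← ih] at this
      rw [nestedComm]
      refine Eq.trans ?_ this
      simp [lcomm]
  have h1 := key k i
  rw [h, map_one, Units.ext_iff, letterUnit_val] at h1
  have h2 := congrArg (fun f : Module.End C (C × V) => (f (1, 0)).2) h1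
  simpa using h2.symm

end PluckerForms

section PluckerQuotients

variable {C V : Type*} [CommRing C] [AddCommGroup V] [Module C V]

theorem nestedVector_mem_of_nestedComm_eq_one (h2 : (2 : C) = 0) (B : V →ₗ[C] V →ₗ[C] C)
    (J : Ideal C) (W : Submodule C V) (hJW : ∀ c ∈ J, ∀ v, c • v ∈ W)
    (hWJ : ∀ v ∈ W, ∀ v', B v v' ∈ J) (alt : ∀ v, B v v = 0) (symm : ∀ v w, B v w = B w v)
    (plucker : ∀ u v w, B u v • w + B v w • u + B w u • v = 0)
    (cyclic : ∀ a b p q r,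
      (B a p * B b q) • r + (B a q * B b r) • p + (B a r * B b p) • q ∈ W)
    (w : ℕ → V) (hw : ∀ i x, B (w i) x • w i ∈ W) {k i : ℕ}
    (h : nestedComm (fun i => (PresentedGroup.of i : H)) k i = 1) : nestedVector B w k i ∈ W := by
  by_cases hJ : J = ⊤
  · have := hJW 1 (hJ ▸ Submodule.mem_top) (nestedVector B w k i)
    rwa [one_smul] at this
  have : Nontrivial (C ⧸ J) := Ideal.Quotient.nontrivial_iff.2 hJ
  have : CharP (C ⧸ J) 2 := CharTwo.of_one_ne_zero_of_two_eq_zero one_ne_zero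
    (by rw [← map_ofNat (Ideal.Quotient.mk J), h2, map_zero])
  have tors : Module.IsTorsionBySet C (V ⧸ W) J := by
    rintro x ⟨c, hc⟩
    obtain ⟨v, rfl⟩ := W.mkQ_surjective x
    rw [← map_smul]
    exact (Submodule.Quotient.mk_eq_zero W).2 (hJW c hc v)
  let _ : Module (C ⧸ J) (V ⧸ W) := tors.module
  have smul_mk : ∀ (c : C) (v : V), (Ideal.Quotient.mk J c) • W.mkQ v = W.mkQ (c • v) :=
    fun c v => rfl
  let f₁ : V →ₗ[C] (V ⧸ W) →ₗ[C] (C ⧸ J) :=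
    LinearMap.flip (W.liftQ (LinearMap.flip (LinearMap.compr₂ B J.mkQ)) (by
      intro v hv
      refine LinearMap.ext fun v' => ?_
      refine (Submodule.Quotient.mk_eq_zero J).2 ?_
      rw [symm]
      exact hWJ v hv v'))
  let f : (V ⧸ W) →ₗ[C] (V ⧸ W) →ₗ[C] (C ⧸ J) := W.liftQ f₁ (by
    intro v hv
    refine LinearMap.ext fun x => ?_
    obtain ⟨v', rfl⟩ := W.mkQ_surjective x
    exact (Submodule.Quotient.mk_eq_zero J).2 (hWJ v hv v'))
  have f_mk : ∀ v v', f (W.mkQ v) (W.mkQ v') = Ideal.Quotient.mk J (B v v') := fun _ _ => rfl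
  have surj := W.mkQ_surjective
  have surjJ := Ideal.Quotient.mk_surjective (I := J)
  let B' : (V ⧸ W) →ₗ[C ⧸ J] (V ⧸ W) →ₗ[C ⧸ J] (C ⧸ J) :=
    LinearMap.mk₂ (C ⧸ J) (fun v v' => f v v') (by simp) (by
      intro c v v'
      obtain ⟨c, rfl⟩ := surjJ c
      exact LinearMap.congr_fun (map_smul f c v) v') (by simp) (by
      intro c v v'
      obtain ⟨c, rfl⟩ := surjJ c
      exact map_smul (f v) c v')
  have B'_mk : ∀ v v', B' (W.mkQ v) (W.mkQ v') = Ideal.Quotient.mk J (B v v') := fun _ _ => rfl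
  have hB' : IsPluckerForm B' := by
    constructor
    · intro v
      obtain ⟨v, rfl⟩ := surj v
      rw [B'_mk, alt, map_zero]
    · intro v w
      obtain ⟨v, rfl⟩ := surj v
      obtain ⟨w, rfl⟩ := surj w
      rw [B'_mk, B'_mk, symm]
    · intro u v w
      obtain ⟨u, rfl⟩ := surj u
      obtain ⟨v, rfl⟩ := surj v
      obtain ⟨w, rfl⟩ := surj w
      simp only [B'_mk, smul_mk, ← map_add, plucker, map_zero]
    · intro a b p q r
      obtain ⟨a, rfl⟩ := surj a
      obtain ⟨b, rfl⟩ := surj b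
      obtain ⟨p, rfl⟩ := surj p
      obtain ⟨q, rfl⟩ := surj q
      obtain ⟨r, rfl⟩ := surj r
      simp only [B'_mk, ← map_mul, smul_mk, ← map_add]
      exact (Submodule.Quotient.mk_eq_zero W).2 (cyclic a b p q r)
  have hw' : ∀ i, IsLetter B' (W.mkQ (w i)) := by
    intro i x
    obtain ⟨x, rfl⟩ := surj x
    rw [B'_mk, smul_mk]
    exact (Submodule.Quotient.mk_eq_zero W).2 (hw i x)
  have h0 := nestedVector_eq_zero hB' hw' h
  have h1 : ∀ k i, nestedVector B' (fun i => W.mkQ (w i)) k i = W.mkQ (nestedVector B w k i) := by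
    intro k
    induction k with
    | zero => intro i; rfl
    | succ k ih => intro i; rw [nestedVector, ih, ih, B'_mk, smul_mk]; rfl
  rw [h1] at h0
  exact (Submodule.Quotient.mk_eq_zero W).1 h0

end PluckerQuotients

section Model

open MvPolynomial

variable {E : Type*} [CommRing E] (ξ : ℕ → E)

/-- The substitution `s_i ↦ s_i (1 + ξ_i x)`. -/
noncomputable def scaling : MvPolynomial ℕ E →+* Polynomial (MvPolynomial ℕ E) :=
  eval₂Hom (Polynomial.C.comp C) fun i => Polynomial.C (X i) * (1 + Polynomial.C (C (ξ i)) * Polynomial.X)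

/-- The coefficient of `s_0 ⋯ s_{n-1}`. -/
noncomputable def multilinearCoeff (E : Type*) [CommRing E] (n : ℕ) : MvPolynomial ℕ E →ₗ[E] E :=
  lcoeff E (∑ i ∈ Finset.range n, Finsupp.single i 1)

lemma multilinearCoeff_coeff_scaling {n : ℕ}
    (hξ : ∏ i ∈ Finset.range n, (1 + Polynomial.C (ξ i) * Polynomial.X) = 1)
    (z : MvPolynomial ℕ E) (k : ℕ) :
    multilinearCoeff E n ((scaling ξ z).coeff (k + 1)) = 0 := by
  induction z using MvPolynomial.induction_on' with
  | add p q hp hq => rw [map_add, Polynomial.coeff_add, map_add, hp, hq, add_zero]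
  | monomial m c =>
    have key : scaling ξ (monomial m c) = Polynomial.C (monomial m c) *
        Polynomial.mapRingHom C (m.prod fun i e => (1 + Polynomial.C (ξ i) * Polynomial.X) ^ e) := by
      rw [scaling, coe_eval₂Hom, eval₂_monomial]
      simp only [mul_pow, Finsupp.prod_mul, monomial_eq, map_mul]
      simp only [Finsupp.prod, map_prod, map_pow, RingHom.comp_apply, map_add, map_one, map_mul,
        Polynomial.coe_mapRingHom, Polynomial.map_C, Polynomial.map_X, mul_assoc]
    rw [key, Polynomial.coeff_C_mul, Polynomial.coe_mapRingHom, Polynomial.coeff_map]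
    rw [multilinearCoeff, lcoeff_apply, mul_comm, coeff_C_mul, coeff_monomial]
    split_ifs with hm
    · have : (m.prod fun i e => (1 + Polynomial.C (ξ i) * Polynomial.X) ^ e) = 1 := by
        refine Eq.trans ?_ hξ
        rw [hm, ← Finsupp.prod_finsetSum_index (by simp) (by simp [pow_add])]
        refine Finset.prod_congr rfl fun i _ => ?_
        rw [Finsupp.prod_single_index (by simp), pow_one]
      rw [this]
      simp [Polynomial.coeff_one]
    · simp

lemma multilinearCoeff_X_sq_mul (n i : ℕ) (z : MvPolynomial ℕ E) :
    multilinearCoeff E n (X i ^ 2 * z) = 0 := by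
  rw [multilinearCoeff, lcoeff_apply, X_pow_eq_monomial, coeff_monomial_mul', if_neg]
  intro h
  have := h i
  have h2 : (∑ j ∈ Finset.range n, Finsupp.single j 1 : ℕ →₀ ℕ) i ≤ 1 := by
    rw [Finsupp.finsetSum_apply]
    simp only [Finsupp.single_apply]
    rw [Finset.sum_ite_eq']
    split_ifs <;> simp
  rw [Finsupp.single_eq_same] at this
  omega

lemma multilinearCoeff_prod_mul (n : ℕ) (c : E) :
    multilinearCoeff E n (C c * ∏ i ∈ Finset.range n, X i) = c := by
  rw [multilinearCoeff, lcoeff_apply, coeff_C_mul]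
  have : (∏ i ∈ Finset.range n, X i : MvPolynomial ℕ E) =
      monomial (∑ i ∈ Finset.range n, Finsupp.single i 1) 1 := by
    rw [monomial_sum_one]; rfl
  rw [this, coeff_monomial, if_pos rfl, mul_one]

/-- The subring of elements fixed by the substitution. -/
def scalingFixed : Subring (MvPolynomial ℕ E) where
  carrier := {z | scaling ξ z = Polynomial.C z}
  mul_mem' := fun {a b} ha hb => by
    simp only [Set.mem_ofPred_eq, map_mul] at *; rw [ha, hb]
  one_mem' := by simp
  add_mem' := fun {a b} ha hb => by
    simp only [Set.mem_ofPred_eq, map_add] at *; rw [ha, hb]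
  zero_mem' := by simp
  neg_mem' := fun {a} ha => by
    simp only [Set.mem_ofPred_eq, map_neg] at *; rw [ha]

/-- Pairs on which the substitution acts as `(v₁, v₂) ↦ (v₁ + v₂ x, v₂)`. -/
def scalingPairs : Submodule (scalingFixed ξ) (MvPolynomial ℕ E × MvPolynomial ℕ E) where
  carrier := {v | scaling ξ v.1 = Polynomial.C v.1 + Polynomial.C v.2 * Polynomial.X ∧
    scaling ξ v.2 = Polynomial.C v.2}
  add_mem' := fun {a b} ha hb => by
    simp only [Set.mem_ofPred_eq, Prod.fst_add, Prod.snd_add, map_add] at *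
    rw [ha.1, ha.2, hb.1, hb.2]
    exact ⟨by ring, rfl⟩
  zero_mem' := by simp
  smul_mem' := fun c v hv => by
    have hc : scaling ξ (c : MvPolynomial ℕ E) = Polynomial.C (c : MvPolynomial ℕ E) := c.2
    simp only [Set.mem_ofPred_eq, Prod.smul_fst, Prod.smul_snd, Subring.smul_def, smul_eq_mul,
      map_mul] at *
    rw [hv.1, hv.2, hc]
    exact ⟨by ring, rfl⟩

variable [CharP E 2]

/-- The determinant form on pairs. -/
noncomputable def pairForm :
    scalingPairs ξ →ₗ[scalingFixed ξ] scalingPairs ξ →ₗ[scalingFixed ξ] scalingFixed ξ :=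
  LinearMap.mk₂ _ (fun v w => ⟨v.1.1 * w.1.2 + v.1.2 * w.1.1, by
    have hv := v.2
    have hw := w.2
    have h2 : (2 : Polynomial (MvPolynomial ℕ E)) = 0 := CharTwo.two_eq_zero
    change scaling ξ _ = Polynomial.C _
    simp only [map_add, map_mul, hv.1, hv.2, hw.1, hw.2]
    linear_combination Polynomial.C v.1.2 * Polynomial.C w.1.2 * Polynomial.X * h2⟩)
    (fun u v w => Subtype.ext (by simp; ring))
    (fun c v w => Subtype.ext (by simp [Subring.smul_def]; ring))
    (fun u v w => Subtype.ext (by simp; ring))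
    (fun c v w => Subtype.ext (by simp [Subring.smul_def]; ring))

@[simp] lemma pairForm_coe (v w : scalingPairs ξ) :
    (pairForm ξ v w : MvPolynomial ℕ E) = v.1.1 * w.1.2 + v.1.2 * w.1.1 := rfl

/-- The letters `(s_i, ξ_i s_i)`. -/
noncomputable def scalingLetter (hsq : ∀ i, ξ i * ξ i = 0) (i : ℕ) : scalingPairs ξ :=
  ⟨(X i, C (ξ i) * X i), by
    constructor
    · simp [scaling]
      ring
    · have h : Polynomial.C (C (ξ i)) * Polynomial.C (C (ξ i)) =
          (0 : Polynomial (MvPolynomial ℕ E)) := by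
        rw [← map_mul, ← map_mul, hsq, map_zero, map_zero]
      simp only [scaling, coe_eval₂Hom, map_mul, eval₂_C, eval₂_X, eval₂_mul, RingHom.comp_apply]
      linear_combination Polynomial.C (X i) * Polynomial.X * h⟩

/-- The ideal of constants annihilated by the coefficient functional. -/
noncomputable def annihilatedConstants (n : ℕ) : Ideal (scalingFixed ξ) where
  carrier := {c | ∀ v : scalingPairs ξ, multilinearCoeff E n (c * v.1.1) = 0}
  add_mem' := fun ha hb v => by
    simp [add_mul, ha v, hb v]
  zero_mem' := by simp
  smul_mem' := fun c a ha v => by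
    have := ha (c • v)
    simp only [Subring.smul_def, smul_eq_mul, Subring.coe_mul, Submodule.coe_smul, Prod.smul_fst] at *
    rw [← this]; congr 1; ring

/-- The submodule of pairs annihilated by the coefficient functional. -/
noncomputable def annihilatedPairs (n : ℕ) : Submodule (scalingFixed ξ) (scalingPairs ξ) where
  carrier := {v | (∀ c : scalingFixed ξ, multilinearCoeff E n (c * v.1.1) = 0) ∧
    ∀ w, pairForm ξ v w ∈ annihilatedConstants ξ n}
  add_mem' := fun ha hb => ⟨fun c => by simp [mul_add, ha.1 c, hb.1 c], fun w => by
    rw [map_add]; exact add_mem (ha.2 w) (hb.2 w)⟩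
  zero_mem' := by simp
  smul_mem' := fun c v hv => ⟨fun d => by
    have := hv.1 (d * c)
    simpa [Subring.smul_def, mul_assoc] using this, fun w => by
    rw [map_smul]; exact Ideal.mul_mem_left _ _ (hv.2 w)⟩

lemma smul_mem_annihilatedPairs {n : ℕ} {c : scalingFixed ξ} (hc : c ∈ annihilatedConstants ξ n)
    (v : scalingPairs ξ) : c • v ∈ annihilatedPairs ξ n := by
  refine ⟨fun d => ?_, fun w => ?_⟩
  · have := hc (d • v)
    simp only [Subring.smul_def, smul_eq_mul, Submodule.coe_smul, Prod.smul_fst] at *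
    rw [← this]; congr 1; ring
  · rw [map_smul, LinearMap.smul_apply]; exact Ideal.mul_mem_right _ _ hc

lemma scalingLetter_mem (hsq : ∀ i, ξ i * ξ i = 0) (n i : ℕ) (v : scalingPairs ξ) :
    pairForm ξ (scalingLetter ξ hsq i) v • scalingLetter ξ hsq i ∈ annihilatedPairs ξ n := by
  refine ⟨fun d => ?_, fun w u => ?_⟩
  · refine Eq.trans (congrArg _ ?_) (multilinearCoeff_X_sq_mul n i ((d : MvPolynomial ℕ E) * (v.1.2 + C (ξ i) * v.1.1)))
    simp [Subring.smul_def, scalingLetter]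
    ring
  · refine Eq.trans (congrArg _ ?_) (multilinearCoeff_X_sq_mul n i
      ((v.1.2 + C (ξ i) * v.1.1) * (w.1.2 + C (ξ i) * w.1.1) * u.1.1))
    simp [Subring.smul_def, scalingLetter]
    ring

lemma coeff_mul_linear_zero {R : Type*} [CommRing R] (p : Polynomial R) (a b : R) :
    (p * (Polynomial.C a + Polynomial.C b * Polynomial.X)).coeff 0 = p.coeff 0 * a := by
  simp

lemma coeff_mul_linear_succ {R : Type*} [CommRing R] (p : Polynomial R) (a b : R) (k : ℕ) :
    (p * (Polynomial.C a + Polynomial.C b * Polynomial.X)).coeff (k + 1) =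
      p.coeff (k + 1) * a + p.coeff k * b := by
  rw [mul_add, ← mul_assoc, Polynomial.coeff_add, Polynomial.coeff_mul_C, Polynomial.coeff_mul_X,
    Polynomial.coeff_mul_C]

lemma cyclic_mem {n : ℕ}
    (hξ : ∏ i ∈ Finset.range n, (1 + Polynomial.C (ξ i) * Polynomial.X) = 1)
    (a b p q r : scalingPairs ξ) :
    (pairForm ξ a p * pairForm ξ b q) • r + (pairForm ξ a q * pairForm ξ b r) • p +
      (pairForm ξ a r * pairForm ξ b p) • q ∈ annihilatedPairs ξ n := by
  have h2 : (2 : MvPolynomial ℕ E) = 0 := CharTwo.two_eq_zero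
  refine ⟨fun d => ?_, fun w u => ?_⟩
  · have hd : scaling ξ (d : MvPolynomial ℕ E) = Polynomial.C (d : MvPolynomial ℕ E) := d.2
    have := multilinearCoeff_coeff_scaling ξ hξ (d * a.1.1 * b.1.1 * p.1.1 * q.1.1 * r.1.1) 1
    simp only [map_mul, hd, a.2.1, b.2.1, p.2.1, q.2.1, r.2.1, coeff_mul_linear_zero,
      coeff_mul_linear_succ, Polynomial.coeff_C_succ, Polynomial.coeff_C_zero] at this
    refine Eq.trans (congrArg _ ?_) this
    simp only [Submodule.coe_add, Submodule.coe_smul, Subring.smul_def, Prod.fst_add, Prod.smul_fst,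
      smul_eq_mul, Subring.coe_mul, pairForm_coe]
    linear_combination (d * a.1.2 * b.1.2 * p.1.1 * q.1.1 * r.1.1 : MvPolynomial ℕ E) * h2
  · have h₁ := multilinearCoeff_coeff_scaling ξ hξ
      (C 1 * a.1.1 * b.1.1 * p.1.1 * q.1.1 * r.1.1 * w.1.1 * u.1.1) 2
    have h₂ := multilinearCoeff_coeff_scaling ξ hξ
      (C 1 * a.1.1 * b.1.1 * p.1.1 * q.1.1 * r.1.1 * w.1.1 * u.1.2) 1
    have h1 : scaling ξ (C 1) = Polynomial.C 1 := by simp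
    simp only [map_mul, u.2.1, u.2.2, a.2.1, b.2.1, p.2.1, q.2.1, r.2.1, w.2.1, h1,
      coeff_mul_linear_zero, coeff_mul_linear_succ, Polynomial.coeff_mul_C, Polynomial.coeff_C_succ,
      Polynomial.coeff_C_zero] at h₁ h₂
    have h₃ := h₁.trans h₂.symm
    rw [← sub_eq_zero, ← map_sub] at h₃
    refine Eq.trans (congrArg _ ?_) h₃
    simp only [Submodule.coe_add, Submodule.coe_smul, Subring.smul_def, Prod.fst_add, Prod.smul_fst,
      Prod.snd_add, Prod.smul_snd, smul_eq_mul, Subring.coe_mul, pairForm_coe]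
    linear_combination (a.1.2 * b.1.2 * p.1.1 * q.1.1 * r.1.1 * w.1.2 * u.1.1 +
      a.1.1 * b.1.1 * p.1.2 * q.1.2 * r.1.2 * w.1.1 * u.1.1 : MvPolynomial ℕ E) * h2

end Model

section Nonsolvable

open MvPolynomial

variable {E : Type*} [CommRing E] {ξ : ℕ → E}

/-- The scalars `c` with `nestedVector w k i = c • w i` when the letters are `(s_i, ξ_i s_i)`. -/
noncomputable def nestedScalar (f : ℕ → E) : ℕ → ℕ → E
  | 0, _ => 1
  | k + 1, i => nestedScalar f k (2 * i + 1) * nestedScalar f k (2 * i + 2) * f i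

lemma prod_nestedScalar_succ (f : ℕ → E) (k p q : ℕ) (h : p ≤ q) :
    ∏ i ∈ Finset.Ico p q, nestedScalar f (k + 1) i =
      (∏ i ∈ Finset.Ico p q, f i) *
        ∏ i ∈ Finset.Ico (2 * p + 1) (2 * q + 1), nestedScalar f k i := by
  induction q, h using Nat.le_induction with
  | base => simp
  | succ q hq ih =>
    rw [Finset.prod_Ico_succ_top hq, Finset.prod_Ico_succ_top hq, ih,
      show 2 * (q + 1) + 1 = 2 * q + 1 + 1 + 1 by ring, Finset.prod_Ico_succ_top (b := 2 * q + 1 + 1) (by omega),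
      Finset.prod_Ico_succ_top (b := 2 * q + 1) (by omega)]
    simp only [nestedScalar]
    ring

lemma prod_nestedScalar (f : ℕ → E) (k p : ℕ) :
    ∏ i ∈ Finset.Ico (2 ^ p - 1) (2 ^ (p + 1) - 1), nestedScalar f k i =
      ∏ i ∈ Finset.Ico (2 ^ p - 1) (2 ^ (p + k) - 1), f i := by
  induction k generalizing p with
  | zero =>
    simp only [nestedScalar, add_zero, Finset.Ico_self, Finset.prod_empty, Finset.prod_const_one]
  | succ k ih =>
    have h1 : 1 ≤ 2 ^ p := Nat.one_le_two_pow
    have h2 : 2 ^ p ≤ 2 ^ (p + 1) := Nat.pow_le_pow_right (by norm_num) (by omega)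
    have h3 : 2 ^ (p + 1) ≤ 2 ^ (p + 1 + k) := Nat.pow_le_pow_right (by norm_num) (by omega)
    rw [prod_nestedScalar_succ _ _ _ _ (by omega),
      show 2 * (2 ^ p - 1) + 1 = 2 ^ (p + 1) - 1 by rw [pow_succ]; omega,
      show 2 * (2 ^ (p + 1) - 1) + 1 = 2 ^ (p + 1 + 1) - 1 by rw [pow_succ]; omega, ih,
      Finset.prod_Ico_consecutive _ (by omega) (by omega), show p + (k + 1) = p + 1 + k by ring]

lemma nestedScalar_zero (f : ℕ → E) (k : ℕ) :
    nestedScalar f k 0 = ∏ i ∈ Finset.range (2 ^ k - 1), f i := by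
  have := prod_nestedScalar f k 0
  simpa using this

lemma prod_range_two_mul_add_one (g : ℕ → E) (K : ℕ) :
    ∏ i ∈ Finset.range (2 * K + 1), g i = g 0 * ∏ i ∈ Finset.range K, (g (2 * i + 1) * g (2 * i + 2)) := by
  induction K with
  | zero => simp
  | succ K ih =>
    rw [show 2 * (K + 1) + 1 = 2 * K + 1 + 1 + 1 by ring, Finset.prod_range_succ,
      Finset.prod_range_succ, ih, Finset.prod_range_succ]
    ring_nf

lemma prod_add_succ_mul_of_sq_zero {η : ℕ → E} (h : ∀ i, η i * η i = 0) (m : ℕ) :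
    (∏ j ∈ Finset.range m, (η j + η (j + 1))) * η m = (∏ j ∈ Finset.range m, η j) * η m := by
  induction m with
  | zero => simp
  | succ m ih =>
    rw [Finset.prod_range_succ, Finset.prod_range_succ]
    linear_combination η (m + 1) * ih + (∏ j ∈ Finset.range m, (η j + η (j + 1))) * h (m + 1)

lemma prod_add_succ_of_sq_zero {η : ℕ → E} (h : ∀ i, η i * η i = 0) {m : ℕ} (hm : η m = 0) :
    ∏ j ∈ Finset.range m, (η j + η (j + 1)) = ∏ j ∈ Finset.range m, η j := by
  cases m with
  | zero => simp
  | succ m =>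
    rw [Finset.prod_range_succ, hm, add_zero, prod_add_succ_mul_of_sq_zero h,
      Finset.prod_range_succ]

lemma prod_one_add_mul_X [CharP E 2] {η : ℕ → E} (h : ∀ i, η i * η i = 0) {K : ℕ} (hK : η K = 0) :
    ∏ i ∈ Finset.range (2 * K + 1), (1 + Polynomial.C (η (i / 2)) * Polynomial.X) = 1 := by
  have key : ∀ m, ∏ i ∈ Finset.range (2 * m),
      (1 + Polynomial.C (η (i / 2)) * Polynomial.X) = (1 : Polynomial E) := by
    intro m
    induction m with
    | zero => simp
    | succ m ih =>
      rw [show 2 * (m + 1) = 2 * m + 1 + 1 by ring, Finset.prod_range_succ,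
        Finset.prod_range_succ, ih, show (2 * m + 1) / 2 = m by omega, show 2 * m / 2 = m by omega]
      have h2 : (2 : Polynomial E) = 0 := CharTwo.two_eq_zero
      have h0 : Polynomial.C (η m) * Polynomial.C (η m) = 0 := by rw [← map_mul, h, map_zero]
      linear_combination Polynomial.C (η m) * Polynomial.X * h2 + Polynomial.X ^ 2 * h0
  rw [Finset.prod_range_succ, key, show 2 * K / 2 = K by omega, hK]
  simp

variable [CharP E 2] (hsq : ∀ i, ξ i * ξ i = 0)

lemma nestedVector_scalingLetter_coe (k i : ℕ) :
    ((nestedVector (pairForm ξ) (scalingLetter ξ hsq) k i : scalingPairs ξ).1.1 =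
      nestedScalar (fun j => X (2 * j + 1) * X (2 * j + 2) *
        C (ξ (2 * j + 1) + ξ (2 * j + 2))) k i * X i) ∧
    ((nestedVector (pairForm ξ) (scalingLetter ξ hsq) k i : scalingPairs ξ).1.2 =
      nestedScalar (fun j => X (2 * j + 1) * X (2 * j + 2) *
        C (ξ (2 * j + 1) + ξ (2 * j + 2))) k i * (C (ξ i) * X i)) := by
  induction k generalizing i with
  | zero => simp [nestedVector, nestedScalar, scalingLetter]
  | succ k ih =>
    obtain ⟨a1, a2⟩ := ih (2 * i + 1)
    obtain ⟨b1, b2⟩ := ih (2 * i + 2)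
    constructor <;>
    · simp only [nestedVector, nestedScalar, Submodule.coe_smul, Subring.smul_def, Prod.smul_fst,
        Prod.smul_snd, smul_eq_mul, pairForm_coe, a1, a2, b1, b2, map_add]
      simp only [scalingLetter]
      ring

theorem nestedComm_ne_one {η : ℕ → E} (h : ∀ i, η i * η i = 0) {k : ℕ}
    (hk : η (2 ^ k - 1) = 0) (hη : ∏ j ∈ Finset.range (2 ^ k - 1), η j ≠ 0) :
    nestedComm (fun i => (PresentedGroup.of i : H)) k 0 ≠ 1 := by
  intro hc
  set K := 2 ^ k - 1 with hK
  have hξ := prod_one_add_mul_X h hk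
  have h2 : (2 : MvPolynomial ℕ E) = 0 := CharTwo.two_eq_zero
  have hsq : ∀ i, η (i / 2) * η (i / 2) = 0 := fun i => h _
  have := nestedVector_mem_of_nestedComm_eq_one (Subtype.ext h2) (pairForm fun i => η (i / 2))
    (annihilatedConstants _ (2 * K + 1)) (annihilatedPairs _ (2 * K + 1))
    (fun c hc v => smul_mem_annihilatedPairs _ hc v) (fun v hv w => hv.2 w)
    (fun v => Subtype.ext (by
      simp only [pairForm_coe, ZeroMemClass.coe_zero]
      linear_combination v.1.1 * v.1.2 * h2))
    (fun v w => Subtype.ext (by simp only [pairForm_coe]; ring))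
    (fun u v w => Subtype.ext (Prod.ext
      (by
        simp only [Submodule.coe_add, Submodule.coe_smul, Subring.smul_def, Prod.fst_add,
          Prod.smul_fst, smul_eq_mul, pairForm_coe, ZeroMemClass.coe_zero, Prod.fst_zero]
        linear_combination (u.1.1 * v.1.2 * w.1.1 + u.1.2 * v.1.1 * w.1.1 +
          u.1.1 * v.1.1 * w.1.2) * h2)
      (by
        simp only [Submodule.coe_add, Submodule.coe_smul, Subring.smul_def, Prod.snd_add,
          Prod.smul_snd, smul_eq_mul, pairForm_coe, ZeroMemClass.coe_zero, Prod.snd_zero]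
        linear_combination (u.1.1 * v.1.2 * w.1.2 + u.1.2 * v.1.1 * w.1.2 +
          u.1.2 * v.1.2 * w.1.1) * h2)))
    (cyclic_mem _ hξ) (scalingLetter _ hsq) (scalingLetter_mem _ hsq _) hc
  have h0 := this.1 1
  rw [(nestedVector_scalingLetter_coe hsq k 0).1, nestedScalar_zero, ← hK] at h0
  refine hη ?_
  rw [← h0, ← prod_add_succ_of_sq_zero h hk]
  refine Eq.trans (multilinearCoeff_prod_mul (2 * K + 1) _).symm (congrArg _ ?_)
  rw [prod_range_two_mul_add_one, Finset.prod_mul_distrib, map_prod]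
  have : ∀ i, (2 * i + 1) / 2 = i ∧ (2 * i + 2) / 2 = i + 1 := by omega
  simp only [this, OneMemClass.coe_one, Finset.prod_mul_distrib]
  ring

theorem nestedComm_of_ne_one (k : ℕ) :
    nestedComm (fun i => (PresentedGroup.of i : H)) k 0 ≠ 1 := by
  let I : Ideal (MvPolynomial ℕ (ZMod 2)) := Ideal.span (Set.range fun i => X i ^ 2)
  let K := 2 ^ k - 1
  let η : ℕ → MvPolynomial ℕ (ZMod 2) ⧸ I := fun j => if j < K then Ideal.Quotient.mk I (X j) else 0
  have hI : ∀ z ∈ I, multilinearCoeff (ZMod 2) K z = 0 := by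
    intro z hz
    refine Submodule.closure_induction (map_zero _) (fun x y _ _ hx hy => ?_)
      (fun a x hx => ?_) hz
    · rw [map_add, hx, hy, add_zero]
    · obtain ⟨i, rfl⟩ := hx
      rw [smul_eq_mul, mul_comm]
      exact multilinearCoeff_X_sq_mul K i a
  have hη : ∏ j ∈ Finset.range K, η j ≠ 0 := by
    have : ∏ j ∈ Finset.range K, η j = Ideal.Quotient.mk I (∏ j ∈ Finset.range K, X j) := by
      rw [map_prod]
      exact Finset.prod_congr rfl fun j hj => if_pos (Finset.mem_range.1 hj)
    rw [this, Ne, Ideal.Quotient.eq_zero_iff_mem]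
    intro h
    have h1 := multilinearCoeff_prod_mul K (1 : ZMod 2)
    rw [C_1, one_mul, hI _ h] at h1
    exact zero_ne_one h1
  have : CharP (MvPolynomial ℕ (ZMod 2) ⧸ I) 2 := CharTwo.of_one_ne_zero_of_two_eq_zero
    (fun h => hη (by rw [← one_mul (∏ j ∈ Finset.range K, η j), h, zero_mul]))
    (by
      have h2 : (2 : MvPolynomial ℕ (ZMod 2)) = 0 := CharTwo.two_eq_zero
      exact (map_ofNat (Ideal.Quotient.mk I) 2).symm.trans
        ((congrArg _ h2).trans (map_zero _)))
  refine nestedComm_ne_one (η := η) (fun i => ?_) (if_neg (lt_irrefl _)) hη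
  by_cases hi : i < K
  · simp only [η, if_pos hi]
    rw [← map_mul, Ideal.Quotient.eq_zero_iff_mem, ← sq]
    exact Ideal.subset_span ⟨i, rfl⟩
  · simp only [η, if_neg hi, zero_mul]

end Nonsolvable

section RightEngel

open scoped commutatorElement

variable {G : Type*} [Group G]

lemma commute_of_lcomm_eq_one {a b : G} (h : lcomm a b = 1) : Commute a b := by
  have : a * b = b * a * lcomm a b := by simp only [lcomm]; group
  rw [h, mul_one] at this
  exact this

lemma commute_commutator_of_commute_sq {n : G} (hn : ∀ x : G, Commute n (x ^ 2)) {m : G}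
    (hm : m ∈ commutator G) : Commute n m := by
  have : commutator G ≤ Subgroup.centralizer {n} := by
    rw [commutator_def, Subgroup.commutator_le]
    intro a _ b _
    rw [Subgroup.mem_centralizer_singleton_iff, eq_comm]
    have : ⁅a, b⁆ = a ^ 2 * (a⁻¹ * b) ^ 2 * (b⁻¹) ^ 2 := by
      rw [commutatorElement_def]; simp only [pow_two]; group
    rw [this]
    exact ((hn _).mul_right (hn _)).mul_right (hn _)
  exact (Subgroup.mem_centralizer_singleton_iff.1 (this hm)).symm

lemma commute_self_of_mem_R2 {n : G} (hn : n ∈ R2 G) (x : G) : Commute (lcomm n x) n := by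
  have h1 := commute_of_lcomm_eq_one (hn x)
  have h2 := commute_of_lcomm_eq_one (hn (x * n))
  have h3 : Commute (lcomm n x) (n * x) := by
    have e1 : lcomm n (x * n) = n⁻¹ * lcomm n x * n := by simp only [lcomm]; group
    rw [e1] at h2
    have h4 : Commute (n * (n⁻¹ * lcomm n x * n) * n⁻¹) (n * (x * n) * n⁻¹) := Commute.conj_iff n |>.2 h2
    convert h4 using 1 <;> group
  have := h3.mul_right h1.inv_right
  rwa [mul_inv_cancel_right] at this

lemma commute_sq_of_mem_R2 {n : G} (hn : n ∈ R2 G) (hn2 : n ^ 2 = 1) (x : G) :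
    Commute n (x ^ 2) := by
  have h1 := commute_of_lcomm_eq_one (hn x)
  have h2 := commute_self_of_mem_R2 hn x
  have h3 : lcomm n x * lcomm n x = 1 := by
    have e : lcomm (n ^ 2) x = n⁻¹ * lcomm n x * n * lcomm n x := by
      simp only [lcomm, pow_two]; group
    rw [mul_assoc n⁻¹, h2.eq, inv_mul_cancel_left, hn2] at e
    rw [← e]
    simp [lcomm]
  refine commute_of_lcomm_eq_one ?_
  have e : lcomm n (x ^ 2) = lcomm n x * (x⁻¹ * lcomm n x * x) := by
    simp only [lcomm, pow_two]; group
  rw [e, mul_assoc x⁻¹, h1.eq, inv_mul_cancel_left, h3]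

end RightEngel

section PresentedH

open scoped commutatorElement

lemma commute_conj_of (i : ℕ) (g h : H) :
    Commute (g⁻¹ * PresentedGroup.of i * g) (h⁻¹ * PresentedGroup.of i * h) := by
  obtain ⟨g, rfl⟩ := PresentedGroup.mk_surjective _ g
  obtain ⟨h, rfl⟩ := PresentedGroup.mk_surjective _ h
  refine commute_of_lcomm_eq_one ?_
  have := PresentedGroup.one_of_mem (rels := Hrels) (Or.inr (Or.inr ⟨i, g, h, rfl⟩))
  simp only [lcomm, map_mul, map_inv] at this ⊢
  exact this

lemma pow_four_eq_one (g : H) : g ^ 4 = 1 := by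
  obtain ⟨g, rfl⟩ := PresentedGroup.mk_surjective _ g
  rw [← map_pow]
  exact PresentedGroup.one_of_mem (rels := Hrels) (Or.inr (Or.inl ⟨g, rfl⟩))

lemma of_mul_of (i : ℕ) : (PresentedGroup.of i * PresentedGroup.of i : H) = 1 := by
  have := PresentedGroup.one_of_mem (rels := Hrels) (Or.inl ⟨i, rfl⟩)
  rwa [map_pow, pow_two] at this

lemma nestedComm_succ_sq (k i : ℕ) :
    nestedComm (fun i => (PresentedGroup.of i : H)) (k + 1) i ^ 2 = 1 := by
  simp only [nestedComm]
  generalize lcomm (nestedComm (fun i => (PresentedGroup.of i : H)) k (2 * i + 1))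
    (nestedComm (fun i => (PresentedGroup.of i : H)) k (2 * i + 2)) = c
  have h := commute_conj_of i c 1
  rw [inv_one, one_mul, mul_one] at h
  have e : lcomm c (PresentedGroup.of i) = (c⁻¹ * PresentedGroup.of i * c) * PresentedGroup.of i := by
    rw [lcomm, inv_eq_of_mul_eq_one_left (of_mul_of i)]
  rw [e, h.mul_pow, pow_two, pow_two, of_mul_of, mul_one,
    show c⁻¹ * PresentedGroup.of i * c * (c⁻¹ * PresentedGroup.of i * c) =
      c⁻¹ * (PresentedGroup.of i * PresentedGroup.of i) * c by group, of_mul_of]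
  group

lemma lcomm_mem_commutator {G : Type*} [Group G] (K L : Subgroup G) {a b : G} (ha : a ∈ K)
    (hb : b ∈ L) : lcomm a b ∈ ⁅K, L⁆ := by
  have := Subgroup.commutator_mem_commutator (inv_mem ha) (inv_mem hb)
  rw [commutatorElement_def] at this
  simpa [lcomm] using this

lemma nestedComm_mem_derivedSeries {G : Type*} [Group G] (x : ℕ → G) (k i : ℕ) :
    nestedComm x k i ∈ derivedSeries G k := by
  induction k generalizing i with
  | zero => simp
  | succ k ih =>
    rw [nestedComm]
    have hn : (derivedSeries G (k + 1)).Normal := derivedSeries_normal G (k + 1)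
    have := lcomm_mem_commutator _ _ (ih (2 * i + 1)) (ih (2 * i + 2))
    exact Subgroup.commutator_le_left _ ⊤ (lcomm_mem_commutator _ _ this (Subgroup.mem_top _))

theorem not_isSolvable_quotient (N : Subgroup H) [N.Normal] (hN : (N : Set H) = R2 H) :
    ¬ IsSolvable (H ⧸ N) := by
  intro ⟨k, hk⟩
  let x : ℕ → H := fun i => PresentedGroup.of i
  have hle : derivedSeries H (k + 1) ≤ N := by
    refine (derivedSeries_antitone H k.le_succ).trans fun z hz => ?_
    have := map_derivedSeries_le_derivedSeries (QuotientGroup.mk' N) k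
      (Subgroup.mem_map_of_mem _ hz)
    rw [hk, Subgroup.mem_bot] at this
    exact (QuotientGroup.eq_one_iff z).1 this
  have h1 : nestedComm x (k + 1) 1 ∈ R2 H :=
    hN ▸ hle (nestedComm_mem_derivedSeries x (k + 1) 1)
  have h2 : nestedComm x (k + 1) 2 ∈ commutator H := by
    rw [← derivedSeries_one]
    exact derivedSeries_antitone H (Nat.le_add_left 1 k)
      (nestedComm_mem_derivedSeries x (k + 1) 2)
  have h3 := commute_commutator_of_commute_sq
    (commute_sq_of_mem_R2 h1 (nestedComm_succ_sq k 1)) h2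
  refine nestedComm_of_ne_one (k + 2) ?_
  change lcomm (lcomm (nestedComm x (k + 1) 1) (nestedComm x (k + 1) 2)) (x 0) = 1
  rw [lcomm_eq_one_of_commute h3, lcomm_eq_one_of_commute (Commute.one_left _)]

end PresentedH

section CubeIdentities

variable {R : Type*} [Ring R]

/-- The part of `(1 + (1 + X) h)³ h⁻¹` that is linear in `X`, up to commuting factors of `h`. -/
def cubeForm (h X : R) : R := X + h * X + X * h + h * h * X + h * X * h + X * h * h

variable [CharP R 2]

lemma cubeForm_add (h X Y : R) : cubeForm h (X + Y) = cubeForm h X + cubeForm h Y := by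
  simp only [cubeForm, mul_add, add_mul]
  abel

lemma one_add_pow_three (h : R) : (1 + h) ^ 3 = 1 + h + h * h + h * h * h := by
  grind

lemma cubeForm_eq_zero {h k X : R} (hk : h * k = 1) (hc0 : (1 + h) ^ 3 = 0)
    (hc : (1 + (1 + X) * h) ^ 3 = 0) (h0 : X * X = 0) (h1 : X * h * X = 0)
    (h2 : X * h * h * X = 0) : cubeForm h X = 0 := by
  have hk' : ∀ z, h * (k * z) = z := fun z => by rw [← mul_assoc, hk, one_mul]
  have h0' : ∀ z, X * (X * z) = 0 := fun z => by rw [← mul_assoc, h0, zero_mul]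
  have h1' : ∀ z, X * (h * (X * z)) = 0 := fun z => by
    rw [← mul_assoc, ← mul_assoc, h1, zero_mul]
  have h2' : ∀ z, X * (h * (h * (X * z))) = 0 := fun z => by
    rw [← mul_assoc, ← mul_assoc, ← mul_assoc, h2, zero_mul]
  rw [one_add_pow_three] at hc0 hc
  have e1 := congrArg (fun z => z * k) hc0
  have e2 := congrArg (fun z => z * k) hc
  simp only [cubeForm, mul_add, add_mul, mul_assoc, one_mul, mul_one, hk, hk', h0', h1', h2',
    mul_zero, zero_mul, add_zero, zero_add] at e1 e2 ⊢
  linear_combination (norm := skip) e2 - e1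
  grind

variable {h k U X : R}

lemma sandwich_mul_conj (hk : h * k = 1) (hU : U * U = 0) (hUX : U * X * U = 0)
    (h1 : cubeForm h X = 0) (h2 : cubeForm ((1 + U) * h) X = 0) :
    U * h * U * (h * X * k) = U * h * X * U + U * X * h * U := by
  have hk' : ∀ z, h * (k * z) = z := fun z => by rw [← mul_assoc, hk, one_mul]
  have hU' : ∀ z, U * (U * z) = 0 := fun z => by rw [← mul_assoc, hU, zero_mul]
  have hX : U * (X * U) = 0 := by rw [← mul_assoc, hUX]
  have hX' : ∀ z, U * (X * (U * z)) = 0 := fun z => by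
    rw [← mul_assoc, ← mul_assoc, hUX, zero_mul]
  have e1 := congrArg (fun z => U * z * k) h1
  have e2 := congrArg (fun z => U * z * k) h2
  simp only [cubeForm, mul_add, add_mul, mul_assoc, one_mul, mul_one, hk, hk', hU, hU', hX, hX',
    mul_zero, zero_mul, add_zero, zero_add] at e1 e2 ⊢
  linear_combination (norm := skip) e2 - e1
  grind

lemma conj_mul_sandwich (hk : k * h = 1) (hU : U * U = 0) (hUX : U * X * U = 0)
    (h1 : cubeForm h X = 0) (h2 : cubeForm (h * (1 + U)) X = 0) :
    k * X * h * (U * h * U) = U * h * X * U + U * X * h * U := by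
  have hk' : ∀ z, k * (h * z) = z := fun z => by rw [← mul_assoc, hk, one_mul]
  have hU' : ∀ z, U * (U * z) = 0 := fun z => by rw [← mul_assoc, hU, zero_mul]
  have hX : U * (X * U) = 0 := by rw [← mul_assoc, hUX]
  have hX' : ∀ z, U * (X * (U * z)) = 0 := fun z => by
    rw [← mul_assoc, ← mul_assoc, hUX, zero_mul]
  have e1 := congrArg (fun z => k * z * U) h1
  have e2 := congrArg (fun z => k * z * U) h2
  simp only [cubeForm, mul_add, add_mul, mul_assoc, one_mul, mul_one, hk, hk', hU, hU', hX, hX',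
    mul_zero, zero_mul, add_zero, zero_add] at e1 e2 ⊢
  linear_combination (norm := skip) e2 - e1
  grind

lemma sandwich_sandwich (hk : k * h = 1) (hU : U * U = 0) (h1 : (1 + h) ^ 3 = 0)
    (h2 : (1 + h * (1 + U)) ^ 3 = 0) : U * h * U * h * U = 0 := by
  have hk' : ∀ z, k * (h * z) = z := fun z => by rw [← mul_assoc, hk, one_mul]
  have hU' : ∀ z, U * (U * z) = 0 := fun z => by rw [← mul_assoc, hU, zero_mul]
  rw [one_add_pow_three] at h1 h2
  have e1 := congrArg (fun z => U * k * z * U) h1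
  have e2 := congrArg (fun z => U * k * z * U) h2
  simp only [mul_add, add_mul, mul_assoc, one_mul, mul_one, hk, hk', hU, hU',
    mul_zero, zero_mul, add_zero, zero_add] at e1 e2 ⊢
  linear_combination (norm := skip) e2 - e1
  grind

lemma sandwich_mul_self (hk : k * h = 1) (hU : U * U = 0) (h1 : (1 + h) ^ 3 = 0)
    (h2 : (1 + h * (1 + U)) ^ 3 = 0) : U * (h * h) * U = U * h * U * (1 + h) := by
  have h3 := sandwich_sandwich hk hU h1 h2
  have hk' : ∀ z, k * (h * z) = z := fun z => by rw [← mul_assoc, hk, one_mul]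
  have hU' : ∀ z, U * (U * z) = 0 := fun z => by rw [← mul_assoc, hU, zero_mul]
  rw [one_add_pow_three] at h1 h2
  have e1 := congrArg (fun z => U * k * z) h1
  have e2 := congrArg (fun z => U * k * z) h2
  simp only [mul_add, add_mul, mul_assoc, one_mul, mul_one, hk, hk', hU, hU',
    mul_zero, zero_mul, add_zero, zero_add] at e1 e2 h3 ⊢
  linear_combination (norm := skip) e2 - e1 - h3
  grind

lemma self_mul_sandwich (hk : h * k = 1) (hkh : k * h = 1) (hU : U * U = 0) (h1 : (1 + h) ^ 3 = 0)
    (h2 : (1 + h * (1 + U)) ^ 3 = 0) (h2' : (1 + (1 + U) * h) ^ 3 = 0) :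
    U * (h * h) * U = (1 + h) * (U * h * U) := by
  have h3 := sandwich_sandwich hkh hU h1 h2
  have hk' : ∀ z, h * (k * z) = z := fun z => by rw [← mul_assoc, hk, one_mul]
  have hU' : ∀ z, U * (U * z) = 0 := fun z => by rw [← mul_assoc, hU, zero_mul]
  rw [one_add_pow_three] at h1 h2'
  have e1 := congrArg (fun z => z * k * U) h1
  have e2 := congrArg (fun z => z * k * U) h2'
  simp only [mul_add, add_mul, mul_assoc, one_mul, mul_one, hk, hk', hU, hU',
    mul_zero, zero_mul, add_zero, zero_add] at e1 e2 h3 ⊢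
  linear_combination (norm := skip) e2 - e1 - h3
  grind

/-- The defect of the cube identity for an element of square zero. -/
lemma cubeForm_of_sq_zero (hkh : k * h = 1) (hU : U * U = 0) (h1 : (1 + h) ^ 3 = 0)
    (h2 : (1 + h * (1 + U)) ^ 3 = 0) (hc : h * (U * h * U) = U * h * U * h) :
    cubeForm h U = U * h * U * h := by
  have h3 := sandwich_sandwich hkh hU h1 h2
  have h4 := sandwich_mul_self hkh hU h1 h2
  have hk' : ∀ z, k * (h * z) = z := fun z => by rw [← mul_assoc, hkh, one_mul]
  rw [one_add_pow_three] at h1 h2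
  have e1 := congrArg (fun z => k * z) h1
  have e2 := congrArg (fun z => k * z) h2
  simp only [cubeForm, mul_add, add_mul, mul_assoc, one_mul, mul_one, hkh, hk', hU,
    mul_zero, zero_mul, add_zero, zero_add] at e1 e2 h3 h4 hc ⊢
  linear_combination (norm := skip) e2 - e1 - h3 - h4 - hc
  grind

end CubeIdentities

section EngelRing

variable {R Γ : Type*} [Ring R] [CharP R 2] [Group Γ]

/-- A representation of a group generated by letters, on which every element acts with
`(1 + g)³ = 0` and letters act by `1 + X` with `X E X = 0`, together with an element acting by
`1 + U` with `U² = 0`. -/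
structure EngelRep (ρ : Γ →* R) (S : Set Γ) (u : Γ) : Prop where
  conj : ∀ s ∈ S, ∀ g, g⁻¹ * s * g ∈ S
  cube : ∀ g, (1 + ρ g) ^ 3 = 0
  letter : ∀ s ∈ S, ∀ g, (1 + ρ s) * ρ g * (1 + ρ s) = 0
  closure : Submonoid.closure S = ⊤
  sq : (1 + ρ u) * (1 + ρ u) = 0

namespace EngelRep

variable {ρ : Γ →* R} {S : Set Γ} {u : Γ}

lemma add_self_zero (a : R) : a + a = 0 := CharTwo.add_self_eq_zero a

lemma mul_inv (g : Γ) : ρ g * ρ g⁻¹ = 1 := by rw [← map_mul, mul_inv_cancel, map_one]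

lemma inv_mul (g : Γ) : ρ g⁻¹ * ρ g = 1 := by rw [← map_mul, inv_mul_cancel, map_one]

/-- The sandwich `U ρ(g) U`. -/
def phi (ρ : Γ →* R) (u g : Γ) : R := (1 + ρ u) * ρ g * (1 + ρ u)

lemma rep_eq (g : Γ) : ρ g = 1 + (1 + ρ g) := by rw [← add_assoc, add_self_zero, zero_add]

lemma letter_mul_self (hρ : EngelRep ρ S u) {s : Γ} (hs : s ∈ S) : ρ s * ρ s = 1 := by
  have := hρ.letter s hs 1
  simp only [map_one, mul_one, mul_add, add_mul, one_mul] at this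
  linear_combination (norm := skip) this
  grind

lemma pow_four (hρ : EngelRep ρ S u) (g : Γ) : ρ g * ρ g * ρ g * ρ g = 1 := by
  have := hρ.cube g
  rw [one_add_pow_three] at this
  linear_combination (norm := skip) this * (1 + ρ g)
  grind

lemma cubeForm_letter (hρ : EngelRep ρ S u) {s : Γ} (hs : s ∈ S) (g : Γ) :
    cubeForm (ρ g) (1 + ρ s) = 0 := by
  refine cubeForm_eq_zero (mul_inv g) (hρ.cube g) ?_ ?_ (hρ.letter s hs g) ?_
  · rw [← rep_eq, ← map_mul]; exact hρ.cube _
  · simpa using hρ.letter s hs 1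
  · have := hρ.letter s hs (g * g)
    rwa [map_mul, ← mul_assoc] at this

lemma phi_letter (hρ : EngelRep ρ S u) {s : Γ} (hs : s ∈ S) :
    (1 + ρ u) * (1 + ρ s) * (1 + ρ u) = 0 := by
  have := hρ.cubeForm_letter hs u
  have h2 := hρ.sq
  unfold cubeForm at this
  linear_combination (norm := skip) this - h2 * (1 + ρ s) - (1 + ρ s) * h2
  grind

/-- The letter `[s, u]` also satisfies the linearized cube identity. -/
lemma cubeForm_comm_letter (hρ : EngelRep ρ S u) {s : Γ} (hs : s ∈ S) (g : Γ) :
    cubeForm (ρ g) ((1 + ρ u) * (1 + ρ s) + (1 + ρ s) * (1 + ρ u)) = 0 := by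
  have hUX := hρ.phi_letter hs
  have hu : ρ u * ρ u = 1 := by
    linear_combination (norm := skip) hρ.sq
    grind
  have e : (1 + ρ u) * (1 + ρ s) + (1 + ρ s) * (1 + ρ u) =
      (1 + ρ s) + ρ u * (1 + ρ s) * ρ u := by
    linear_combination (norm := skip) hUX
    grind
  have key : ∀ h, ((1 + ρ s) + ρ u * (1 + ρ s) * ρ u) * ρ h *
      ((1 + ρ s) + ρ u * (1 + ρ s) * ρ u) = 0 := by
    intro h
    have h1 := hρ.letter s hs h
    have h2 := hρ.letter s hs (h * u)
    have h3 := hρ.letter s hs (u * h)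
    have h4 := hρ.letter s hs (u * h * u)
    simp only [map_mul] at h2 h3 h4
    linear_combination (norm := skip) h1 + h2 * ρ u + ρ u * h3 + ρ u * h4 * ρ u
    grind
  rw [e]
  refine cubeForm_eq_zero (mul_inv g) (hρ.cube g) ?_ ?_ (key g) ?_
  · have h5 : 1 + ((1 + ρ s) + ρ u * (1 + ρ s) * ρ u) = ρ (s * (u * s * u)) := by
      have := hρ.letter s hs u
      simp only [map_mul]
      linear_combination (norm := skip) - this * ρ u + ρ s * hu
      grind
    rw [h5, ← map_mul]
    exact hρ.cube _
  · have := key 1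
    rwa [map_one, mul_one] at this
  · have := key (g * g)
    rwa [map_mul, ← mul_assoc] at this

/-- Sandwiches and letters. -/
lemma phi_mul_conj (hρ : EngelRep ρ S u) {s : Γ} (hs : s ∈ S) (g : Γ) :
    phi ρ u g * ρ (g * s * g⁻¹) = phi ρ u g + phi ρ u (g * s) + phi ρ u (s * g) := by
  have h := sandwich_mul_conj (mul_inv g) hρ.sq (hρ.phi_letter hs) (hρ.cubeForm_letter hs g)
    (by rw [← rep_eq, ← map_mul]; exact hρ.cubeForm_letter hs _)
  have h1 := mul_inv (ρ := ρ) g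
  simp only [phi, map_mul]
  linear_combination (norm := skip) h - (1 + ρ u) * ρ g * (1 + ρ u) * h1
  grind

lemma conj_mul_phi (hρ : EngelRep ρ S u) {s : Γ} (hs : s ∈ S) (g : Γ) :
    ρ (g⁻¹ * s * g) * phi ρ u g = phi ρ u g + phi ρ u (g * s) + phi ρ u (s * g) := by
  have h := conj_mul_sandwich (inv_mul g) hρ.sq (hρ.phi_letter hs) (hρ.cubeForm_letter hs g)
    (by rw [← rep_eq, ← map_mul]; exact hρ.cubeForm_letter hs _)
  have h1 := inv_mul (ρ := ρ) g
  simp only [phi, map_mul]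
  linear_combination (norm := skip) h - h1 * ((1 + ρ u) * ρ g * (1 + ρ u))
  grind

lemma cube_mul_right (hρ : EngelRep ρ S u) (g : Γ) : (1 + ρ g * (1 + (1 + ρ u))) ^ 3 = 0 := by
  rw [← rep_eq, ← map_mul]; exact hρ.cube _

lemma cube_mul_left (hρ : EngelRep ρ S u) (g : Γ) : (1 + (1 + (1 + ρ u)) * ρ g) ^ 3 = 0 := by
  rw [← rep_eq, ← map_mul]; exact hρ.cube _

lemma phi_commute_self (hρ : EngelRep ρ S u) (g : Γ) : ρ g * phi ρ u g = phi ρ u g * ρ g := by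
  have h1 := sandwich_mul_self (inv_mul g) hρ.sq (hρ.cube g) (hρ.cube_mul_right g)
  have h2 := self_mul_sandwich (mul_inv g) (inv_mul g) hρ.sq (hρ.cube g) (hρ.cube_mul_right g)
    (hρ.cube_mul_left g)
  simp only [phi]
  linear_combination (norm := skip) h1 - h2
  grind

/-- `ψ(g) = φ(g) g²`. -/
lemma commute_letter (hρ : EngelRep ρ S u) {s : Γ} (hs : s ∈ S) (g : Γ) :
    phi ρ u g * ρ (g * g) * ρ s = ρ s * (phi ρ u g * ρ (g * g)) := by
  have h1 := (hρ.phi_mul_conj hs g).trans (hρ.conj_mul_phi hs g).symm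
  have hc := hρ.phi_commute_self g
  calc phi ρ u g * ρ (g * g) * ρ s = phi ρ u g * ρ g * (ρ g * ρ s) := by
        rw [map_mul]; simp only [mul_assoc]
    _ = ρ g * (phi ρ u g * ρ (g * s * g⁻¹)) * ρ g := by
        rw [← hc]; simp only [mul_assoc, map_mul, inv_mul, mul_one]
    _ = ρ s * (ρ g * phi ρ u g * ρ g) := by
        rw [h1, map_mul, map_mul]
        simp only [← mul_assoc, mul_inv, one_mul]
    _ = _ := by rw [hc, map_mul, mul_assoc]

lemma commute_all (hρ : EngelRep ρ S u) (g h : Γ) :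
    phi ρ u g * ρ (g * g) * ρ h = ρ h * (phi ρ u g * ρ (g * g)) := by
  have : h ∈ Submonoid.closure S := hρ.closure ▸ Submonoid.mem_top h
  induction this using Submonoid.closure_induction with
  | mem x hx => exact hρ.commute_letter hx g
  | one => simp
  | mul a b _ _ ha hb => rw [map_mul ρ a b, ← mul_assoc, ha, mul_assoc, hb, mul_assoc]

lemma phi_mul_letter (hρ : EngelRep ρ S u) {s : Γ} (hs : s ∈ S) (g : Γ) :
    phi ρ u g * ρ s = phi ρ u (s * (g⁻¹ * s * g) * g) := by
  have h := hρ.phi_mul_conj (hρ.conj s hs g) g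
  have e1 : g * (g⁻¹ * s * g) * g⁻¹ = s := by group
  have e2 : g * (g⁻¹ * s * g) = s * g := by group
  rw [e1, e2] at h
  have h2 := hρ.letter s hs g⁻¹
  rw [h]
  have h3 : phi ρ u g + phi ρ u (s * g) + phi ρ u (g⁻¹ * s * g * g) +
      phi ρ u (s * (g⁻¹ * s * g) * g) =
      (1 + ρ u) * ((1 + ρ s) * ρ g⁻¹ * (1 + ρ s)) * ρ (g * g) * (1 + ρ u) := by
    have h4 := inv_mul (ρ := ρ) g
    simp only [phi, map_mul]
    linear_combination (norm := skip) - (1 + ρ u) * (1 + ρ s) * h4 * ρ g * (1 + ρ u)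
    grind
  rw [h2] at h3
  linear_combination (norm := skip) h3
  grind

lemma letter_commute (hρ : EngelRep ρ S u) {s : Γ} (hs : s ∈ S) (g : Γ) :
    ρ s * ρ (g⁻¹ * s * g) = ρ (g⁻¹ * s * g) * ρ s := by
  have h1 := hρ.letter s hs g
  have h2 := hρ.letter s hs g⁻¹
  have h3 := inv_mul (ρ := ρ) g
  simp only [map_mul]
  linear_combination (norm := skip) h2 * ρ g - ρ g⁻¹ * h1 + h3 * ρ s - ρ s * h3
  grind

lemma conj_mul_conj_mul (hρ : EngelRep ρ S u) {s : Γ} (hs : s ∈ S) (g : Γ) :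
    ρ (g⁻¹ * s * g) * ρ (g * s * g⁻¹) * ρ s * ρ (g * g) = ρ (g * g) * ρ s := by
  have h1 := hρ.pow_four (s * g)
  have hss := hρ.letter_mul_self hs
  have hss' : ∀ z, ρ s * (ρ s * z) = z := fun z => by rw [← mul_assoc, hss, one_mul]
  have hg' : ∀ z, ρ g * (ρ g⁻¹ * z) = z := fun z => by rw [← mul_assoc, mul_inv, one_mul]
  have hg'' : ∀ z, ρ g⁻¹ * (ρ g * z) = z := fun z => by rw [← mul_assoc, inv_mul, one_mul]
  have c1 : ρ s * ρ (g * s * g⁻¹) = ρ (g * s * g⁻¹) * ρ s := by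
    simpa using hρ.letter_commute hs g⁻¹
  rw [mul_assoc (ρ (g⁻¹ * s * g)), ← c1]
  have e1 : ρ s * (ρ g * (ρ s * (ρ g * (ρ s * ρ g)))) = ρ g⁻¹ * ρ s := by
    have := congrArg (· * (ρ g⁻¹ * ρ s)) h1
    simpa only [map_mul, mul_assoc, hg', hss, mul_one, one_mul] using this
  have e2 : ρ g⁻¹ * ρ g⁻¹ = ρ g * ρ g := by
    have := congrArg (fun z => ρ g⁻¹ * (ρ g⁻¹ * z)) (hρ.pow_four g)
    simp only [mul_assoc, hg'', mul_one] at this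
    exact this.symm
  have e3 := congrArg (· * ρ s) e2
  simp only [map_mul, mul_assoc, hg''] at e1 e3 ⊢
  rw [e1, e3]

/-- `ψ(g) s = ψ(s s^g g)`. -/
lemma psi_mul_letter (hρ : EngelRep ρ S u) {s : Γ} (hs : s ∈ S) (g : Γ) :
    phi ρ u g * ρ (g * g) * ρ s = phi ρ u (s * (g⁻¹ * s * g) * g) *
      ρ ((s * (g⁻¹ * s * g) * g) * (s * (g⁻¹ * s * g) * g)) := by
  have e : (s * (g⁻¹ * s * g) * g) * (s * (g⁻¹ * s * g) * g) =
      s * ((g⁻¹ * s * g) * (g * s * g⁻¹) * s * (g * g)) := by group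
  rw [← hρ.phi_mul_letter hs, e, map_mul ρ s, mul_assoc (phi ρ u g) (ρ s), ← mul_assoc (ρ s),
    hρ.letter_mul_self hs, one_mul, map_mul ρ (_ * s), map_mul ρ _ s, map_mul ρ (_ * g),
    hρ.conj_mul_conj_mul hs, mul_assoc]

lemma exists_psi_eq (hρ : EngelRep ρ S u) (g h : Γ) :
    ∃ k, phi ρ u g * ρ (g * g) * ρ h = phi ρ u k * ρ (k * k) := by
  have : h ∈ Submonoid.closure S := hρ.closure ▸ Submonoid.mem_top h
  induction this using Submonoid.closure_induction generalizing g with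
  | mem x hx => exact ⟨_, hρ.psi_mul_letter hx g⟩
  | one => exact ⟨g, by simp⟩
  | mul a b _ _ ha hb =>
    obtain ⟨k, hk⟩ := ha g
    rw [map_mul ρ a b, ← mul_assoc, hk]
    exact hb k

lemma psi_mul_comm (hρ : EngelRep ρ S u) (g a b : Γ) :
    phi ρ u g * ρ (g * g) * ρ a * ρ b = phi ρ u g * ρ (g * g) * ρ b * ρ a := by
  obtain ⟨k, hk⟩ := hρ.exists_psi_eq g a
  rw [hk, hρ.commute_all, ← hk, ← mul_assoc, ← hρ.commute_all]

lemma psi_mul_sq (hρ : EngelRep ρ S u) (g a : Γ) :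
    phi ρ u g * ρ (g * g) * ρ a * ρ a = phi ρ u g * ρ (g * g) := by
  have : a ∈ Submonoid.closure S := hρ.closure ▸ Submonoid.mem_top a
  induction this using Submonoid.closure_induction with
  | mem x hx => rw [mul_assoc, hρ.letter_mul_self hx, mul_one]
  | one => simp
  | mul a b _ _ ha hb =>
    obtain ⟨k, hk⟩ := hρ.exists_psi_eq g a
    calc _ = phi ρ u g * ρ (g * g) * ρ a * ρ b * ρ a * ρ b := by
          rw [map_mul ρ a b]; simp only [mul_assoc]
      _ = phi ρ u g * ρ (g * g) * ρ a * ρ a * ρ b * ρ b := by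
          rw [hk, hρ.psi_mul_comm]
      _ = _ := by rw [ha, hb]

lemma phi_eq_psi (hρ : EngelRep ρ S u) (g : Γ) : phi ρ u g = phi ρ u g * ρ (g * g) := by
  have := hρ.psi_mul_sq g g⁻¹
  rw [← this]
  conv_lhs => rw [← mul_one (phi ρ u g)]
  simp only [mul_assoc, ← map_mul]
  congr 1
  rw [← map_one ρ]
  congr 1
  group

lemma phi_commute (hρ : EngelRep ρ S u) (g h : Γ) : phi ρ u g * ρ h = ρ h * phi ρ u g := by
  rw [hρ.phi_eq_psi]; exact hρ.commute_all g h

lemma phi_mul_comm (hρ : EngelRep ρ S u) (g a b : Γ) :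
    phi ρ u g * ρ a * ρ b = phi ρ u g * ρ b * ρ a := by
  rw [hρ.phi_eq_psi]; exact hρ.psi_mul_comm g a b

lemma phi_conj (hρ : EngelRep ρ S u) {s : Γ} (hs : s ∈ S) (g : Γ) :
    phi ρ u (s * g * s) = phi ρ u g := by
  have hss := hρ.letter_mul_self hs
  have h1 := cubeForm_of_sq_zero (inv_mul g) hρ.sq (hρ.cube g) (hρ.cube_mul_right g)
    ((hρ.phi_commute g g).symm)
  have h2 := cubeForm_of_sq_zero (inv_mul (s * g * s)) hρ.sq (hρ.cube _) (hρ.cube_mul_right _)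
    ((hρ.phi_commute _ _).symm)
  have h3 := hρ.cubeForm_comm_letter hs (s * g * s)
  change cubeForm _ _ = phi ρ u g * ρ g at h1
  change cubeForm _ _ = phi ρ u (s * g * s) * ρ (s * g * s) at h2
  have h4 : ρ s * cubeForm (ρ g) (1 + ρ u) * ρ s =
      cubeForm (ρ (s * g * s)) (ρ s * (1 + ρ u) * ρ s) := by
    have hss' : ∀ z, ρ s * (ρ s * z) = z := fun z => by rw [← mul_assoc, hss, one_mul]
    simp only [cubeForm, map_mul, mul_assoc, hss, hss', mul_add, add_mul, one_mul, mul_one]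
  have h5 : ρ s * (1 + ρ u) * ρ s =
      (1 + ρ u) + ((1 + ρ u) * (1 + ρ s) + (1 + ρ s) * (1 + ρ u)) := by
    have h6 := hρ.phi_letter hs
    have h7 : (1 + ρ s) * (1 + ρ u) * (1 + ρ s) = 0 := by
      have h8 := hρ.letter s hs u
      have h9 := hρ.letter s hs 1
      rw [map_one] at h9
      linear_combination (norm := skip) h8 + h9
      grind
    linear_combination (norm := skip) h7
    grind
  rw [h5, cubeForm_add _ (1 + ρ u), h3, add_zero, h1, h2] at h4
  have h6 : phi ρ u (s * g * s) * ρ (s * g * s) = phi ρ u (s * g * s) * ρ g := by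
    rw [map_mul, ← mul_assoc, hρ.phi_mul_comm, map_mul, ← mul_assoc, mul_assoc _ (ρ s) (ρ s), hss,
      mul_one]
  have h7 : ρ s * (phi ρ u g * ρ g) * ρ s = phi ρ u g * ρ g := by
    rw [← mul_assoc, ← hρ.phi_commute, hρ.phi_mul_comm, mul_assoc, hss, mul_one]
  rw [h6, h7] at h4
  rw [← mul_one (phi ρ u (s * g * s)), ← mul_one (phi ρ u g), ← mul_inv (ρ := ρ) g, ← mul_assoc,
    ← mul_assoc, h4]

lemma phi_mul_one_add (hρ : EngelRep ρ S u) {s : Γ} (hs : s ∈ S) (g : Γ) :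
    phi ρ u g * (1 + ρ s) = 0 := by
  have hss := hρ.letter_mul_self hs
  have key : ∀ g, phi ρ u (g * s) * (1 + ρ s) = 0 := by
    intro g
    have h := hρ.phi_mul_conj hs (g * s)
    have e1 : phi ρ u (g * s * s) = phi ρ u g := by
      simp only [phi, map_mul, mul_assoc, hss, mul_one]
    have e2 : phi ρ u (g * s) * ρ (g * s * s * (g * s)⁻¹) = phi ρ u (g * s) * ρ s := by
      rw [map_mul, map_mul, ← mul_assoc, ← mul_assoc, hρ.phi_mul_comm, mul_assoc _ (ρ (g * s)), mul_inv, mul_one]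
    rw [e1, e2, ← mul_assoc, hρ.phi_conj hs] at h
    rw [mul_add, mul_one, h]
    grind
  have := key (g * s)
  have e1 : phi ρ u (g * s * s) = phi ρ u g := by
    simp only [phi, map_mul, mul_assoc, hss, mul_one]
  rwa [e1] at this

theorem one_add_mul_phi (hρ : EngelRep ρ S u) {s : Γ} (hs : s ∈ S) (g : Γ) :
    (1 + ρ s) * phi ρ u g = 0 := by
  rw [add_mul, ← hρ.phi_commute, one_mul]
  simpa only [mul_add, mul_one] using hρ.phi_mul_one_add hs g

end EngelRep

end EngelRing

section FiberRing

variable {G E ι : Type*} [Group G] [Ring E] (σ : G →* E) (B : Subgroup G)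

/-- Elements annihilated on both sides by `1 + b` for `b` in `B`, up to the group action. -/
def biannihilator : AddSubgroup E where
  carrier := {r | ∀ b ∈ B, ∀ g, r * σ g * (1 + σ b) = 0 ∧ (1 + σ b) * σ g * r = 0}
  add_mem' := fun hr hs b hb g => by
    constructor
    · rw [add_mul, add_mul, (hr b hb g).1, (hs b hb g).1, add_zero]
    · rw [mul_add _ _ (_ : E), (hr b hb g).2, (hs b hb g).2, add_zero]
  zero_mem' := by simp
  neg_mem' := fun hr b hb g => by
    constructor
    · rw [neg_mul, neg_mul, (hr b hb g).1, neg_zero]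
    · rw [mul_neg, (hr b hb g).2, neg_zero]

/-- Pairs acting identically on `biannihilator`. -/
def fiberRing : Subring (E × E) where
  carrier := {a | ∀ r ∈ biannihilator σ B, a.1 * r = a.2 * r ∧ a.1 * r ∈ biannihilator σ B ∧
    r * a.1 = r * a.2 ∧ r * a.1 ∈ biannihilator σ B}
  mul_mem' := fun {a b} ha hb r hr => by
    obtain ⟨h1, h2, h3, h4⟩ := hb r hr
    obtain ⟨h5, h6, h7, h8⟩ := ha r hr
    refine ⟨?_, ?_, ?_, ?_⟩
    · rw [Prod.fst_mul, Prod.snd_mul, mul_assoc, mul_assoc, ← h1, (ha _ h2).1]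
    · rw [Prod.fst_mul, mul_assoc]; exact (ha _ h2).2.1
    · rw [Prod.fst_mul, Prod.snd_mul, ← mul_assoc, ← mul_assoc, ← h7, (hb _ h8).2.2.1]
    · rw [Prod.fst_mul, ← mul_assoc]; exact (hb _ h8).2.2.2
  one_mem' := fun r hr => by simpa using hr
  add_mem' := fun {a b} ha hb r hr => by
    obtain ⟨h1, h2, h3, h4⟩ := hb r hr
    obtain ⟨h5, h6, h7, h8⟩ := ha r hr
    simp only [Prod.fst_add, Prod.snd_add, add_mul, mul_add]
    exact ⟨by rw [h1, h5], add_mem h6 h2, by rw [h3, h7], add_mem h8 h4⟩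
  zero_mem' := fun r hr => by simp [zero_mem]
  neg_mem' := fun {a} ha r hr => by
    obtain ⟨h5, h6, h7, h8⟩ := ha r hr
    simp only [Prod.fst_neg, Prod.snd_neg, neg_mul, mul_neg]
    exact ⟨by rw [h5], neg_mem h6, by rw [h7], neg_mem h8⟩

/-- The diagonal copy of `biannihilator`. -/
def fiberIdeal : Ideal (fiberRing σ B) where
  carrier := {a | a.1.1 = a.1.2 ∧ a.1.1 ∈ biannihilator σ B}
  add_mem' := fun ha hb => ⟨by simp [ha.1, hb.1], add_mem ha.2 hb.2⟩
  zero_mem' := ⟨rfl, zero_mem _⟩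
  smul_mem' := fun c a ha => by
    obtain ⟨h1, h2, h3, h4⟩ := c.2 _ ha.2
    exact ⟨h1.trans (congrArg _ ha.1), h2⟩

instance : (fiberIdeal σ B).IsTwoSided where
  mul_mem_of_left := fun {a} c ha => by
    obtain ⟨h1, h2, h3, h4⟩ := c.2 _ ha.2
    exact ⟨h3.trans (congrArg (· * _) ha.1), h4⟩

/-- Pairs of group elements congruent modulo `B`. -/
def fiberGroup [B.Normal] : Subgroup (G × G) :=
  MonoidHom.eqLocus ((QuotientGroup.mk' B).comp (MonoidHom.fst G G))
    ((QuotientGroup.mk' B).comp (MonoidHom.snd G G))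

lemma mem_fiberGroup [B.Normal] {x : G × G} : x ∈ fiberGroup B ↔ x.1⁻¹ * x.2 ∈ B := by
  exact QuotientGroup.eq

lemma eq_of_add_eq_zero_of_two {a b : E} (h2 : (2 : E) = 0) (h : a + b = 0) : a = b := by
  rw [eq_neg_of_add_eq_zero_left h, neg_eq_iff_add_eq_zero, ← two_mul, h2, zero_mul]

lemma fiber_mem_fiberRing [B.Normal] {x : G × G} (hx : x ∈ fiberGroup B) (h2 : (2 : E) = 0) :
    (σ x.1, σ x.2) ∈ fiberRing σ B := by
  intro r hr
  have hb := (mem_fiberGroup B).1 hx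
  have hb' : x.2 * x.1⁻¹ ∈ B := by
    have := (‹B.Normal›).conj_mem _ hb x.1
    simpa [mul_assoc] using this
  have e : σ x.2 = σ x.1 * σ (x.1⁻¹ * x.2) := by rw [← map_mul]; simp
  have e' : σ x.2 = σ (x.2 * x.1⁻¹) * σ x.1 := by rw [← map_mul]; simp
  have h := hr _ hb 1
  have h' := hr _ hb' x.1
  rw [map_one, mul_one, mul_one] at h
  refine ⟨?_, fun b hbB g => ⟨?_, ?_⟩, ?_, fun b hbB g => ⟨?_, ?_⟩⟩
  · have := h.2
    rw [add_mul, one_mul] at this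
    rw [e, mul_assoc, ← eq_of_add_eq_zero_of_two h2 this]
  · rw [mul_assoc (σ x.1), mul_assoc (σ x.1), (hr b hbB g).1, mul_zero]
  · rw [← mul_assoc, mul_assoc _ (σ g), ← map_mul, (hr b hbB _).2]
  · have := (hr _ hb 1).1
    have h3 : r * (1 + σ (x.2 * x.1⁻¹)) = 0 := by simpa using (hr _ hb' 1).1
    rw [mul_add, mul_one] at h3
    change r * σ x.1 = r * σ x.2
    rw [e', ← mul_assoc, ← eq_of_add_eq_zero_of_two h2 h3]
  · rw [mul_assoc r, ← map_mul, (hr b hbB _).1]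
  · change (1 + σ b) * σ g * (r * σ x.1) = 0
    rw [← mul_assoc, (hr b hbB g).2, zero_mul]

/-- The representation of pairs congruent modulo `B` on the fiber ring modulo the diagonal ideal. -/
def fiberRep [B.Normal] (h2 : (2 : E) = 0) : fiberGroup B →* fiberRing σ B ⧸ fiberIdeal σ B where
  toFun x := Ideal.Quotient.mk (fiberIdeal σ B) ⟨_, fiber_mem_fiberRing σ B x.2 h2⟩
  map_one' := by
    rw [← map_one (Ideal.Quotient.mk (fiberIdeal σ B))]
    congr 1
    ext <;> simp
  map_mul' x y := by
    refine Eq.trans (congrArg _ ?_) (RingHom.map_mul _ _ _)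
    ext <;> simp

lemma mk_eq_zero_iff (a : fiberRing σ B) : Ideal.Quotient.mk (fiberIdeal σ B) a = 0 ↔
    a.1.1 = a.1.2 ∧ a.1.1 ∈ biannihilator σ B := Ideal.Quotient.eq_zero_iff_mem

theorem one_add_mul_of_fiber [B.Normal] (h2 : (2 : E) = 0) (V : ι → Subgroup G)
    [hV : ∀ i, (V i).Normal] (hcl : Submonoid.closure (⋃ i, (V i : Set G)) = ⊤)
    (hcube : ∀ g, (1 + σ g) ^ 3 = 0)
    (hletter : ∀ i, ∀ x ∈ V i, ∀ g, (1 + σ x) * σ g * (1 + σ x) = 0) {i : ι} (hB : B ≤ V i)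
    {u : G} (hu : (1 + σ u) * (1 + σ u) ∈ biannihilator σ B) {b : G} (hb : b ∈ B) (g : G) :
    (1 + σ b) * ((1 + σ u) * σ g * (1 + σ u)) = 0 := by
  by_cases h1 : (1 : E) ∈ biannihilator σ B
  · have := (h1 b hb 1).2
    rw [map_one, mul_one, mul_one] at this
    rw [this, zero_mul]
  have hne : (1 : fiberRing σ B ⧸ fiberIdeal σ B) ≠ 0 := fun h =>
    h1 ((mk_eq_zero_iff σ B 1).1 h).2
  have htwo : (2 : fiberRing σ B ⧸ fiberIdeal σ B) = 0 := by
    have : (2 : fiberRing σ B) = 0 := by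
      ext
      · exact h2
      · exact h2
    rw [← map_ofNat (Ideal.Quotient.mk (fiberIdeal σ B)) 2, this, map_zero]
  have : CharP (fiberRing σ B ⧸ fiberIdeal σ B) 2 := CharTwo.of_one_ne_zero_of_two_eq_zero hne htwo
  let S : Set (fiberGroup B) := {x | ∃ k, x.1.1 ∈ V k ∧ x.1.2 ∈ V k}
  have hdiag : ∀ g : G, (g, g) ∈ fiberGroup B := fun g => rfl
  have hrep : EngelRep (fiberRep σ B h2) S ⟨(u, u), hdiag u⟩ := by
    refine ⟨?_, ?_, ?_, ?_, ?_⟩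
    · rintro s ⟨k, hk1, hk2⟩ g
      refine ⟨k, ?_, ?_⟩
      · simpa using (hV k).conj_mem _ hk1 g.1.1⁻¹
      · simpa using (hV k).conj_mem _ hk2 g.1.2⁻¹
    · intro g
      refine (mk_eq_zero_iff σ B ((1 + ⟨_, fiber_mem_fiberRing σ B g.2 h2⟩) ^ 3)).2 ?_
      have e1 := hcube g.1.1
      have e2 := hcube g.1.2
      refine ⟨?_, ?_⟩
      · exact e1.trans e2.symm
      · have : (1 + σ g.1.1) ^ 3 ∈ biannihilator σ B := by rw [e1]; exact zero_mem _
        exact this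
    · rintro s ⟨k, hk1, hk2⟩ g
      refine (mk_eq_zero_iff σ B ((1 + ⟨_, fiber_mem_fiberRing σ B s.2 h2⟩) *
        ⟨_, fiber_mem_fiberRing σ B g.2 h2⟩ * (1 + ⟨_, fiber_mem_fiberRing σ B s.2 h2⟩))).2 ?_
      have e1 := hletter k _ hk1 g.1.1
      have e2 := hletter k _ hk2 g.1.2
      refine ⟨e1.trans e2.symm, ?_⟩
      have : (1 + σ s.1.1) * σ g.1.1 * (1 + σ s.1.1) ∈ biannihilator σ B := by
        rw [e1]; exact zero_mem _
      exact this
    · have key : ∀ h : G, ⟨(h, h), hdiag h⟩ ∈ Submonoid.closure S := by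
        intro h
        have hh : h ∈ Submonoid.closure (⋃ i, (V i : Set G)) := hcl ▸ Submonoid.mem_top h
        induction hh using Submonoid.closure_induction with
        | mem x hx =>
          obtain ⟨k, hk⟩ := Set.mem_iUnion.1 hx
          exact Submonoid.subset_closure ⟨k, hk, hk⟩
        | one => exact one_mem _
        | mul x y _ _ hx hy => exact mul_mem hx hy
      refine eq_top_iff.2 fun x _ => ?_
      have hx := (mem_fiberGroup B).1 x.2
      have e : x = ⟨(x.1.1, x.1.1), hdiag _⟩ *
          ⟨(1, x.1.1⁻¹ * x.1.2), (mem_fiberGroup B).2 (by simpa using hx)⟩ := by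
        ext <;> simp
      rw [e]
      exact mul_mem (key _) (Submonoid.subset_closure ⟨i, one_mem _, hB hx⟩)
    · refine (mk_eq_zero_iff σ B ((1 + ⟨_, fiber_mem_fiberRing σ B (hdiag u) h2⟩) *
        (1 + ⟨_, fiber_mem_fiberRing σ B (hdiag u) h2⟩))).2 ⟨rfl, hu⟩
  have hbm : ((1 : G), b) ∈ fiberGroup B := (mem_fiberGroup B).2 (by simpa using hb)
  have hs : (⟨(1, b), hbm⟩ : fiberGroup B) ∈ S := ⟨i, one_mem _, hB hb⟩
  have := hrep.one_add_mul_phi hs ⟨(g, g), hdiag g⟩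
  have h3 := (mk_eq_zero_iff σ B ((1 + ⟨_, fiber_mem_fiberRing σ B hbm h2⟩) *
    ((1 + ⟨_, fiber_mem_fiberRing σ B (hdiag u) h2⟩) * ⟨_, fiber_mem_fiberRing σ B (hdiag g) h2⟩ *
      (1 + ⟨_, fiber_mem_fiberRing σ B (hdiag u) h2⟩)))).1 this
  have h4 : (1 + σ 1) * ((1 + σ u) * σ g * (1 + σ u)) =
    (1 + σ b) * ((1 + σ u) * σ g * (1 + σ u)) := h3.1
  rw [← h4, map_one, one_add_one_eq_two, h2, zero_mul]

end FiberRing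

section LeftEngel

open scoped commutatorElement IsMulCommutative

variable {G ι : Type*} [Group G]

/-- The conjugation action on an abelian normal subgroup. -/
def conjEnd (K : Subgroup G) [K.Normal] [IsMulCommutative K] : G →* AddMonoid.End (Additive K) where
  toFun g := MonoidHom.toAdditive (MulAut.conjNormal g : K ≃* K).toMonoidHom
  map_one' := AddMonoidHom.ext fun x => Subtype.ext (by
    change 1 * (x.toMul : G) * 1⁻¹ = x.toMul
    group)
  map_mul' g h := AddMonoidHom.ext fun x => Subtype.ext (by
    change g * h * (x.toMul : G) * (g * h)⁻¹ = g * (h * x.toMul * h⁻¹) * g⁻¹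
    group)

/-- The group element underlying an element of the additive version of a subgroup. -/
def elt {K : Subgroup G} (m : Additive K) : G := (m.toMul : K)

section

variable {K : Subgroup G} [K.Normal] [IsMulCommutative K]

lemma elt_mem (m : Additive K) : elt m ∈ K := m.toMul.2

lemma elt_conjEnd (g : G) (m : Additive K) : elt (conjEnd K g m) = g * elt m * g⁻¹ := rfl

lemma elt_one_add (g : G) (m : Additive K) :
    elt ((1 + conjEnd K g) m) = elt m * (g * elt m * g⁻¹) := by
  rw [← elt_conjEnd]; rfl

lemma end_mul_apply (a b : AddMonoid.End (Additive K)) (m : Additive K) : (a * b) m = a (b m) := rfl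

lemma end_eq_zero {a : AddMonoid.End (Additive K)} (h : ∀ m, elt (a m) = 1) : a = 0 := by
  ext m; exact h m

lemma elt_eq_one {a : AddMonoid.End (Additive K)} (h : a = 0) (m) : elt (a m) = 1 := by
  rw [h]; rfl

lemma conjEnd_two (hK : ∀ x ∈ K, x * x = 1) : (2 : AddMonoid.End (Additive K)) = 0 := by
  rw [← one_add_one_eq_two]
  exact end_eq_zero fun m => hK _ (elt_mem m)

lemma one_add_mul_self_of_two {E : Type*} [Ring E] (h2 : (2 : E) = 0) (a : E) :
    (1 + a) * (1 + a) = 1 + a * a := by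
  have : (1 + a) * (1 + a) = 1 + a * a + 2 * a := by noncomm_ring
  rw [this, h2, zero_mul, add_zero]

lemma conjEnd_cube (hK : ∀ x ∈ K, x * x = 1) (h4 : ∀ g : G, g ^ 4 = 1) (g : G) :
    (1 + conjEnd K g) ^ 3 = 0 := by
  rw [pow_succ, pow_two, one_add_mul_self_of_two (conjEnd_two hK), ← map_mul]
  refine end_eq_zero fun m => ?_
  rw [end_mul_apply, elt_one_add, elt_one_add]
  have e := h4 (elt m * g)
  have e1 : elt m * (g * elt m * g⁻¹) * (g * g * (elt m * (g * elt m * g⁻¹)) * (g * g)⁻¹) =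
    (elt m * g) ^ 4 * (g ^ 4)⁻¹ := by
    rw [pow_succ (elt m * g) 3, pow_succ (elt m * g) 2, pow_two]; group
  rw [e1, e, h4, inv_one, one_mul]

lemma conjEnd_letter (hK : ∀ x ∈ K, x * x = 1) {L : Subgroup G} [hL : L.Normal]
    (hLc : ∀ x ∈ L, ∀ y ∈ L, Commute x y) {s : G} (hs : s ∈ L) (g : G) :
    (1 + conjEnd K s) * conjEnd K g * (1 + conjEnd K s) = 0 := by
  refine end_eq_zero fun m => ?_
  rw [end_mul_apply, end_mul_apply, elt_one_add, elt_conjEnd, elt_one_add]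
  have hm := hK _ (elt_mem m)
  have h1 : elt m * (s * elt m * s⁻¹) ∈ L := by
    have := mul_mem (hL.conj_mem _ hs (elt m)) (inv_mem hs)
    rwa [inv_eq_of_mul_eq_one_left hm, mul_assoc, mul_assoc, ← mul_assoc s] at this
  have h2 := hL.conj_mem _ h1 g
  have h3 : g * (elt m * (s * elt m * s⁻¹)) * g⁻¹ ∈ K :=
    ‹K.Normal›.conj_mem _ (mul_mem (elt_mem m) (‹K.Normal›.conj_mem _ (elt_mem m) s)) g
  rw [(hLc _ hs _ h2).eq, mul_inv_cancel_right, hK _ h3]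

lemma mem_biannihilator_conjEnd (hK : ∀ x ∈ K, x * x = 1) (h4 : ∀ g : G, g ^ 4 = 1)
    {N : Subgroup G} [hNn : N.Normal] (hN : (N : Set G) = R2 G) {u : G} (hu : u * u ∈ N)
    {B : Subgroup G} (hB : B ≤ commutator G) :
    (1 + conjEnd K u) * (1 + conjEnd K u) ∈ biannihilator (conjEnd K) B := by
  have hcomm : ∀ n ∈ N, n ^ 2 = 1 → ∀ m ∈ commutator G, Commute n m := fun n hn hn2 m hm =>
    commute_commutator_of_commute_sq (commute_sq_of_mem_R2 (hN ▸ hn) hn2) hm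
  rw [one_add_mul_self_of_two (conjEnd_two hK), ← map_mul]
  have huu : (u * u) ^ 2 = 1 := by rw [← h4 u, ← pow_two, ← pow_mul]
  generalize u * u = n at hu huu
  intro b hb g
  constructor
  · refine end_eq_zero fun m => ?_
    rw [end_mul_apply, end_mul_apply, elt_one_add, elt_conjEnd, elt_one_add]
    have hm := hK _ (elt_mem m)
    have h1 : elt m * (b * elt m * b⁻¹) ∈ commutator G := by
      have := lcomm_mem_commutator ⊤ ⊤ (Subgroup.mem_top (elt m)) (Subgroup.mem_top b⁻¹)
      rwa [lcomm, inv_inv, inv_eq_of_mul_eq_one_left hm, mul_assoc, mul_assoc, ← mul_assoc b] at this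
    have h2 := (inferInstance : (commutator G).Normal).conj_mem _ h1 g
    have h3 : g * (elt m * (b * elt m * b⁻¹)) * g⁻¹ ∈ K :=
      ‹K.Normal›.conj_mem _ (mul_mem (elt_mem m) (‹K.Normal›.conj_mem _ (elt_mem m) b)) g
    rw [(hcomm _ hu huu _ h2).eq, mul_inv_cancel_right, hK _ h3]
  · refine end_eq_zero fun m => ?_
    rw [end_mul_apply, end_mul_apply, elt_one_add, elt_conjEnd, elt_one_add]
    have hm := hK _ (elt_mem m)
    have h1 : elt m * (n * elt m * n⁻¹) ∈ N := by
      have := mul_mem (hNn.conj_mem _ hu (elt m)) (inv_mem hu)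
      rwa [inv_eq_of_mul_eq_one_left hm, mul_assoc, mul_assoc, ← mul_assoc n] at this
    have h2 := hNn.conj_mem _ h1 g
    have h3 : g * (elt m * (n * elt m * n⁻¹)) * g⁻¹ ∈ K :=
      ‹K.Normal›.conj_mem _ (mul_mem (elt_mem m) (‹K.Normal›.conj_mem _ (elt_mem m) n)) g
    rw [← (hcomm _ h2 (by rw [pow_two, hK _ h3]) _ (hB hb)).eq, mul_inv_cancel_right, hK _ h3]

end

lemma mem_R2_of_commute_sq {K : Subgroup G} [hKn : K.Normal] (hK : ∀ x ∈ K, x * x = 1)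
    (hKc : ∀ x ∈ K, ∀ y ∈ K, Commute x y) {z : G} (hz : z ∈ K) (h : ∀ x : G, Commute z (x ^ 2)) :
    z ∈ R2 G := by
  intro x
  refine lcomm_eq_one_of_commute ?_
  have hzi : z⁻¹ = z := inv_eq_of_mul_eq_one_left (hK z hz)
  have h1 : Commute z (x⁻¹ * z * x) := hKc _ hz _ (by simpa using hKn.conj_mem _ hz x⁻¹)
  have h2 := (h x).eq
  have e : z * (x⁻¹ * z * x) * x = x * (x⁻¹ * (z * (x⁻¹ * (z * x ^ 2)))) := by
    rw [pow_two]; group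
  rw [h2] at e
  rw [lcomm, hzi, mul_assoc (z * x⁻¹), mul_assoc z, ← mul_assoc x⁻¹]
  change _ = _
  rw [e]
  have e2 : x⁻¹ * (z * (x⁻¹ * (x ^ 2 * z))) = (x⁻¹ * z * x) * z := by rw [pow_two]; group
  rw [e2, h1.eq]

lemma commute_sq_of_commute_inf {V : ι → Subgroup G} [hV : ∀ i, (V i).Normal]
    (hVs : ∀ i, ∀ x ∈ V i, x * x = 1)
    (hcl : Submonoid.closure (⋃ i, (V i : Set G)) = ⊤) {z : G}
    (hz : ∀ i, ∀ b ∈ V i ⊓ commutator G, Commute z b) (w : G) : Commute z (w ^ 2) := by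
  have hw : w ∈ Submonoid.closure (⋃ i, (V i : Set G)) := hcl ▸ Submonoid.mem_top w
  induction hw using Submonoid.closure_induction_left with
  | one => simp
  | mul_left x hx y _ ih =>
    obtain ⟨i, hi⟩ := Set.mem_iUnion.1 hx
    have e : (x * y) ^ 2 = lcomm x⁻¹ y⁻¹ * y ^ 2 := by
      rw [lcomm, inv_inv, inv_inv, inv_eq_of_mul_eq_one_left (hVs i x hi), pow_two, pow_two]
      group
    rw [e]
    refine (hz i _ ⟨?_, lcomm_mem_commutator ⊤ ⊤ (Subgroup.mem_top _) (Subgroup.mem_top _)⟩).mul_right ih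
    have := mul_mem hi ((hV i).conj_mem _ (inv_mem hi) y)
    simpa [lcomm, mul_assoc] using this

theorem conj_commutator_mem {V : ι → Subgroup G} [hV : ∀ i, (V i).Normal]
    (hVs : ∀ i, ∀ x ∈ V i, x * x = 1) (hVc : ∀ i, ∀ x ∈ V i, ∀ y ∈ V i, Commute x y)
    (hcl : Submonoid.closure (⋃ i, (V i : Set G)) = ⊤) (h4 : ∀ g : G, g ^ 4 = 1)
    {N : Subgroup G} [hNn : N.Normal] (hN : (N : Set G) = R2 G) {u : G} (hu : u * u ∈ N)
    {j : ι} {v : G} (hv : v ∈ V j) (g : G) :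
    g * (v * (u * v * u⁻¹)) * g⁻¹ * (u * (g * (v * (u * v * u⁻¹)) * g⁻¹) * u⁻¹) ∈ N := by
  have : IsMulCommutative (V j) := ⟨⟨fun x y => Subtype.ext (hVc j x x.2 y y.2)⟩⟩
  have hmem : g * (v * (u * v * u⁻¹)) * g⁻¹ * (u * (g * (v * (u * v * u⁻¹)) * g⁻¹) * u⁻¹) ∈ V j := by
    have h1 := (hV j).conj_mem _ (mul_mem hv ((hV j).conj_mem _ hv u)) g
    exact mul_mem h1 ((hV j).conj_mem _ h1 u)
  rw [← SetLike.mem_coe, hN]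
  refine mem_R2_of_commute_sq (hVs j) (hVc j) hmem ?_
  refine commute_sq_of_commute_inf hVs hcl fun i b hb => ?_
  have key := one_add_mul_of_fiber (conjEnd (V j)) (V i ⊓ commutator G) (conjEnd_two (hVs j)) V hcl
    (conjEnd_cube (hVs j) h4) (fun i x hx g => conjEnd_letter (hVs j) (hVc i) hx g) inf_le_left
    (mem_biannihilator_conjEnd (hVs j) h4 hN hu inf_le_right) hb g
  have := elt_eq_one key (Additive.ofMul ⟨v, hv⟩)
  rw [end_mul_apply, end_mul_apply, end_mul_apply, elt_one_add,
    elt_one_add, elt_conjEnd, elt_one_add] at this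
  change g * (v * (u * v * u⁻¹)) * g⁻¹ * (u * (g * (v * (u * v * u⁻¹)) * g⁻¹) * u⁻¹) * (b *
    (g * (v * (u * v * u⁻¹)) * g⁻¹ * (u * (g * (v * (u * v * u⁻¹)) * g⁻¹) * u⁻¹)) * b⁻¹) = 1 at this
  generalize g * (v * (u * v * u⁻¹)) * g⁻¹ * (u * (g * (v * (u * v * u⁻¹)) * g⁻¹) * u⁻¹) = z
    at this hmem
  have h1 := eq_inv_of_mul_eq_one_right this
  rw [inv_eq_of_mul_eq_one_left (hVs j z hmem), mul_inv_eq_iff_eq_mul] at h1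
  exact h1.symm

theorem lcomm_lcomm_quotient {V : ι → Subgroup G} [hV : ∀ i, (V i).Normal]
    (hVs : ∀ i, ∀ x ∈ V i, x * x = 1) (hVc : ∀ i, ∀ x ∈ V i, ∀ y ∈ V i, Commute x y)
    (hcl : Submonoid.closure (⋃ i, (V i : Set G)) = ⊤) (h4 : ∀ g : G, g ^ 4 = 1)
    {N : Subgroup G} [hNn : N.Normal] (hN : (N : Set G) = R2 G) {u : G ⧸ N} (hu : u ^ 2 = 1)
    (x : G ⧸ N) : lcomm (lcomm x u) u = 1 := by
  obtain ⟨u, rfl⟩ := QuotientGroup.mk'_surjective N u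
  have huN : u * u ∈ N := by
    rw [← map_pow, pow_two] at hu
    exact (QuotientGroup.eq_one_iff _).1 hu
  have hui : ∀ w : G, w * w ∈ N → (QuotientGroup.mk' N w)⁻¹ = QuotientGroup.mk' N w := fun w hw => by
    refine inv_eq_of_mul_eq_one_left ?_
    rw [← map_mul]
    exact (QuotientGroup.eq_one_iff _).2 hw
  have hconj : ∀ x : G, Commute (QuotientGroup.mk' N (x * u * x⁻¹)) (QuotientGroup.mk' N u) := by
    intro x
    have hx : x ∈ Submonoid.closure (⋃ i, (V i : Set G)) := hcl ▸ Submonoid.mem_top x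
    induction hx using Submonoid.closure_induction_right with
    | one => simp
    | mul_right y _ v hv ih =>
      obtain ⟨j, hj⟩ := Set.mem_iUnion.1 hv
      have hvj := (hV j).conj_mem _ (mul_mem hj ((hV j).conj_mem _ hj u)) y
      have h1 := conj_commutator_mem hVs hVc hcl h4 hN huN hj y
      have hvi : v⁻¹ = v := inv_eq_of_mul_eq_one_left (hVs j v hj)
      have e : y * v * u * (y * v)⁻¹ = y * (v * (u * v * u⁻¹)) * y⁻¹ * (y * u * y⁻¹) := by
        rw [mul_inv_rev, hvi]; group
      rw [e, map_mul]
      refine Commute.mul_left ?_ ih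
      generalize y * (v * (u * v * u⁻¹)) * y⁻¹ = c at h1 hvj
      have h2 : QuotientGroup.mk' N (c * (u * c * u⁻¹)) = 1 := (QuotientGroup.eq_one_iff _).2 h1
      rw [map_mul] at h2
      have h3 := eq_inv_of_mul_eq_one_right h2
      rw [hui c (by rw [hVs j c hvj]; exact one_mem _), map_mul, map_inv,
        mul_inv_eq_iff_eq_mul, map_mul] at h3
      exact h3.symm
  refine lcomm_eq_one_of_commute ?_
  obtain ⟨x, rfl⟩ := QuotientGroup.mk'_surjective N x
  have := hconj x⁻¹
  rw [map_mul, map_mul, inv_inv, map_inv] at this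
  rw [lcomm, hui u huN]
  exact this.mul_left (Commute.refl _)

end LeftEngel

section NormalClosure

lemma commute_of_mem_normalClosure {i : ℕ} {x y : H}
    (hx : x ∈ Subgroup.normalClosure {(PresentedGroup.of i : H)})
    (hy : y ∈ Subgroup.normalClosure {(PresentedGroup.of i : H)}) : Commute x y := by
  have h : ∀ a ∈ Group.conjugatesOfSet {(PresentedGroup.of i : H)}, ∃ g : H,
      a = g⁻¹ * PresentedGroup.of i * g := by
    intro a ha
    obtain ⟨b, rfl, hb⟩ := Group.mem_conjugatesOfSet_iff.1 ha
    obtain ⟨c, rfl⟩ := isConj_iff.1 hb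
    exact ⟨c⁻¹, by rw [inv_inv]⟩
  have hc := Subgroup.isMulCommutative_closure
    (k := Group.conjugatesOfSet {(PresentedGroup.of i : H)}) fun a ha b hb => by
      obtain ⟨g, rfl⟩ := h a ha
      obtain ⟨k, rfl⟩ := h b hb
      exact (commute_conj_of i g k).eq
  exact congrArg Subtype.val (hc.is_comm.comm ⟨x, hx⟩ ⟨y, hy⟩)

lemma mul_self_of_mem_normalClosure {i : ℕ} {x : H}
    (hx : x ∈ Subgroup.normalClosure {(PresentedGroup.of i : H)}) : x * x = 1 := by
  have hx' := hx
  rw [Subgroup.normalClosure] at hx'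
  induction hx' using Subgroup.closure_induction with
  | mem a ha =>
    obtain ⟨b, rfl, hb⟩ := Group.mem_conjugatesOfSet_iff.1 ha
    obtain ⟨c, rfl⟩ := isConj_iff.1 hb
    rw [← pow_two, conj_pow, pow_two, of_mul_of, mul_one, mul_inv_cancel]
  | one => exact mul_one 1
  | mul a b ha hb iha ihb =>
    rw [← pow_two, (commute_of_mem_normalClosure ha hb).mul_pow, pow_two, pow_two, iha ha, ihb hb,
      mul_one]
  | inv a ha iha => rw [← mul_inv_rev, iha ha, inv_one]

lemma closure_normalClosure_of : Submonoid.closure (⋃ i,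
    (Subgroup.normalClosure {(PresentedGroup.of i : H)} : Set H)) = ⊤ := by
  have hinv : (⋃ i, (Subgroup.normalClosure {(PresentedGroup.of i : H)} : Set H))⁻¹ =
      ⋃ i, (Subgroup.normalClosure {(PresentedGroup.of i : H)} : Set H) := by
    simp
  have h := Subgroup.closure_toSubmonoid
    (⋃ i, (Subgroup.normalClosure {(PresentedGroup.of i : H)} : Set H))
  rw [hinv, Set.union_self] at h
  rw [← h]
  have : Subgroup.closure (⋃ i, (Subgroup.normalClosure {(PresentedGroup.of i : H)} : Set H)) = ⊤ := by
    rw [eq_top_iff, ← PresentedGroup.closure_range_of, Subgroup.closure_le]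
    rintro _ ⟨i, rfl⟩
    exact Subgroup.subset_closure (Set.mem_iUnion.2 ⟨i, Subgroup.subset_normalClosure rfl⟩)
  rw [this]
  rfl

end NormalClosure

/-- Let `N` be a normal subgroup of `H` whose underlying set is `R₂(H)` and let
`H̄ = H/N`. Then every involution of `H̄` is a left 2-Engel element of `H̄`, and `H̄`
is not solvable. -/
theorem stmt_5 (N : Subgroup H) [N.Normal] (hN : (N : Set H) = R2 H) :
    (∀ u : H ⧸ N, u ^ 2 = 1 → ∀ x : H ⧸ N, lcomm (lcomm x u) u = 1) ∧
      ¬ IsSolvable (H ⧸ N) := by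
  exact ⟨fun _ hu x => lcomm_lcomm_quotient (fun _ _ => mul_self_of_mem_normalClosure)
    (fun _ _ hx _ => commute_of_mem_normalClosure hx) closure_normalClosure_of pow_four_eq_one hN hu x,
    not_isSolvable_quotient N hN⟩
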